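/- arXiv:1212.3898 — 3 statements merged into one kernel-verified Lean document; each statement's English description precedes it below -/
import Mathlib

section
/- Let m be an odd integer with m ≥ 3 and let G be a non-complete finite simple graph with maximum degree Δ(G) ≥ 3. Then for n = 2m+1, χ(G^{m/n}) ≤ ω(G^{m/n}) + 1. -/
open SimpleGraph

/-- Representations of vertices of the `n`-subdivision of `G`: `(u, u, 0)` represents the
branch vertex `u`, and for an adjacent pair `(u, v)`, the triple `(u, v, i)` with `i ≤ n`
represents the point at distance `i` from `u` on the path of length `n` replacing the
edge `uv`. -/
def SubdivPre {V : Type*} (G : SimpleGraph V) (n : ℕ) : Type _ :=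
  {p : V × V × ℕ // (p.1 = p.2.1 ∧ p.2.2 = 0) ∨ (G.Adj p.1 p.2.1 ∧ p.2.2 ≤ n)}

/-- The identifications between representations: `(u, v, i)` and `(v, u, n - i)` represent
the same point, and `(u, v, 0)` represents the branch vertex `u`, i.e. `(u, u, 0)`. -/
inductive SubdivRel {V : Type*} (G : SimpleGraph V) (n : ℕ) :
    SubdivPre G n → SubdivPre G n → Prop
  | flip (u v : V) (i : ℕ) (h : G.Adj u v) (hi : i ≤ n) :
      SubdivRel G n ⟨(u, v, i), Or.inr ⟨h, hi⟩⟩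
        ⟨(v, u, n - i), Or.inr ⟨h.symm, Nat.sub_le n i⟩⟩
  | collapse (u v : V) (h : G.Adj u v) :
      SubdivRel G n ⟨(u, v, 0), Or.inr ⟨h, Nat.zero_le n⟩⟩ ⟨(u, u, 0), Or.inl ⟨rfl, rfl⟩⟩

/-- The vertex set of the `n`-subdivision of `G`. -/
def SubdivVert {V : Type*} (G : SimpleGraph V) (n : ℕ) : Type _ := Quot (SubdivRel G n)

/-- The branch vertex of the subdivision corresponding to a vertex `u` of `G`. -/
def branchVertex {V : Type*} (G : SimpleGraph V) (n : ℕ) (u : V) : SubdivVert G n :=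
  Quot.mk _ ⟨(u, u, 0), Or.inl ⟨rfl, rfl⟩⟩

/-- The vertex `(uv)_i` of the subdivision: the point at distance `i` from `u` on the
path of length `n` replacing the edge `uv`. -/
def mkVert {V : Type*} (G : SimpleGraph V) (n : ℕ) {u v : V} (h : G.Adj u v)
    (i : ℕ) (hi : i ≤ n) : SubdivVert G n :=
  Quot.mk _ ⟨(u, v, i), Or.inr ⟨h, hi⟩⟩

/-- The `n`-subdivision `G^{1/n}` of `G`: each edge of `G` is replaced by a path of
length `n`; consecutive points on such a path are adjacent. -/
def subdivision {V : Type*} (G : SimpleGraph V) (n : ℕ) : SimpleGraph (SubdivVert G n) :=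
  SimpleGraph.fromRel (fun x y => ∃ (u v : V) (h : G.Adj u v) (i : ℕ) (hi : i < n),
    x = mkVert G n h i (le_of_lt hi) ∧ y = mkVert G n h (i + 1) hi)

/-- The `m`-power of a graph: two distinct vertices are adjacent iff their distance is
at most `m`, i.e. iff there is a walk of length at most `m` between them. -/
def powerGraph {W : Type*} (H : SimpleGraph W) (m : ℕ) : SimpleGraph W :=
  SimpleGraph.fromRel (fun x y => ∃ w : H.Walk x y, w.length ≤ m)

/-- The fractional power `G^{m/n}`, the `m`-power of the `n`-subdivision of `G`. -/
def fracPower {V : Type*} (G : SimpleGraph V) (m n : ℕ) : SimpleGraph (SubdivVert G n) :=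
  powerGraph (subdivision G n) m

/-- Half-edge colouring conditions. -/
structure HalfCol {V : Type*} (G : SimpleGraph V) (m : ℕ) {K : Type*} (L : V → V → ℕ → K) :
    Prop where
  star : ∀ u v w, G.Adj u v → G.Adj u w → v ≠ w → ∀ i j, 1 ≤ i → 1 ≤ j → i + j ≤ m →
    L u v i ≠ L u w j
  half : ∀ u v, G.Adj u v → ∀ i j, 1 ≤ i → i ≤ m → 1 ≤ j → j ≤ m → i ≠ j → L u v i ≠ L u v j
  edge : ∀ u v, G.Adj u v → ∀ i j, 1 ≤ i → i ≤ m → 1 ≤ j → j ≤ m → m + 1 ≤ i + j →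
    L u v i ≠ L v u j

/-- Being within distance `d` of `(u, v, i)`, on representations. -/
def nearPre {V : Type*} (n : ℕ) (u v : V) (i d : ℕ) (p : V × V × ℕ) : Prop :=
  (p.1 = u ∧ p.2.1 = v ∧ i ≤ p.2.2 + d ∧ p.2.2 ≤ i + d) ∨
  (p.2.1 = u ∧ p.1 = v ∧ i ≤ (n - p.2.2) + d ∧ (n - p.2.2) ≤ i + d) ∨
  (p.1 = u ∧ i + p.2.2 ≤ d) ∨ (p.2.1 = u ∧ i + (n - p.2.2) ≤ d)

theorem nearPre_respects {V : Type*} (G : SimpleGraph V) (m : ℕ) (u v : V) (i d : ℕ)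
    (hi : i ≤ m) (hd : d ≤ m) (x y : SubdivPre G (2 * m + 1))
    (h : SubdivRel G (2 * m + 1) x y) :
    nearPre (2 * m + 1) u v i d x.1 = nearPre (2 * m + 1) u v i d y.1 := by
  cases h with
  | flip a b j hab hj =>
    have e : 2 * m + 1 - (2 * m + 1 - j) = j := by omega
    simp only [nearPre, e]
    apply propext
    constructor
    · rintro (h | h | h | h)
      · exact Or.inr (Or.inl h)
      · exact Or.inl h
      · exact Or.inr (Or.inr (Or.inr h))
      · exact Or.inr (Or.inr (Or.inl h))
    · rintro (h | h | h | h)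
      · exact Or.inr (Or.inl h)
      · exact Or.inl h
      · exact Or.inr (Or.inr (Or.inr h))
      · exact Or.inr (Or.inr (Or.inl h))
  | collapse a b hab =>
    simp only [nearPre]
    apply propext
    constructor
    · rintro (⟨h1, h2, h3, h4⟩ | ⟨h1, h2, h3, h4⟩ | ⟨h1, h2⟩ | ⟨h1, h2⟩)
      · exact Or.inr (Or.inr (Or.inl ⟨h1, by omega⟩))
      · omega
      · exact Or.inr (Or.inr (Or.inl ⟨h1, by omega⟩))
      · omega
    · rintro (⟨h1, h2, h3, h4⟩ | ⟨h1, h2, h3, h4⟩ | ⟨h1, h2⟩ | ⟨h1, h2⟩)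
      · exact Or.inr (Or.inr (Or.inl ⟨h1, by omega⟩))
      · omega
      · exact Or.inr (Or.inr (Or.inl ⟨h1, by omega⟩))
      · omega

/-- Being within distance `d` of `(u, v, i)`. -/
def Near {V : Type*} (G : SimpleGraph V) (m : ℕ) (u v : V) (i d : ℕ)
    (hi : i ≤ m) (hd : d ≤ m) : SubdivVert G (2 * m + 1) → Prop :=
  Quot.lift (fun p => nearPre (2 * m + 1) u v i d p.1) (nearPre_respects G m u v i d hi hd)

theorem near_step {V : Type*} (G : SimpleGraph V) (m : ℕ) (u v : V) (i d : ℕ)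
    (hi : i ≤ m) (hd : d + 1 ≤ m) (x y : SubdivVert G (2 * m + 1))
    (h : (subdivision G (2 * m + 1)).Adj x y) (hx : Near G m u v i d hi (by omega) x) :
    Near G m u v i (d + 1) hi hd y := by
  rw [subdivision, SimpleGraph.fromRel_adj] at h
  obtain ⟨-, ⟨a, b, hab, j, hj, rfl, rfl⟩ | ⟨a, b, hab, j, hj, rfl, rfl⟩⟩ := h
  · change nearPre _ _ _ _ _ (a, b, j) at hx
    change nearPre _ _ _ _ _ (a, b, j + 1)
    simp only [nearPre] at hx ⊢
    rcases hx with ⟨h1, h2, h3, h4⟩ | ⟨h1, h2, h3, h4⟩ | ⟨h1, h2⟩ | ⟨h1, h2⟩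
    · exact Or.inl ⟨h1, h2, by omega, by omega⟩
    · exact Or.inr (Or.inl ⟨h1, h2, by omega, by omega⟩)
    · exact Or.inr (Or.inr (Or.inl ⟨h1, by omega⟩))
    · exact Or.inr (Or.inr (Or.inr ⟨h1, by omega⟩))
  · change nearPre _ _ _ _ _ (a, b, j + 1) at hx
    change nearPre _ _ _ _ _ (a, b, j)
    simp only [nearPre] at hx ⊢
    rcases hx with ⟨h1, h2, h3, h4⟩ | ⟨h1, h2, h3, h4⟩ | ⟨h1, h2⟩ | ⟨h1, h2⟩
    · exact Or.inl ⟨h1, h2, by omega, by omega⟩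
    · exact Or.inr (Or.inl ⟨h1, h2, by omega, by omega⟩)
    · exact Or.inr (Or.inr (Or.inl ⟨h1, by omega⟩))
    · exact Or.inr (Or.inr (Or.inr ⟨h1, by omega⟩))

theorem near_walk {V : Type*} (G : SimpleGraph V) (m : ℕ) (u v : V) (i : ℕ)
    (hi : i ≤ m) (x y : SubdivVert G (2 * m + 1))
    (w : (subdivision G (2 * m + 1)).Walk x y) :
    ∀ d (hd : d + w.length ≤ m), Near G m u v i d hi (by omega) x →
      Near G m u v i (d + w.length) hi hd y := by
  induction w with
  | nil => intro d hd h; exact h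
  | cons h p ih =>
    intro d hd hx
    simp only [SimpleGraph.Walk.length_cons] at hd ⊢
    have := ih (d + 1) (by omega) (near_step G m u v i d hi (by omega) _ _ h hx)
    convert this using 1
    omega

theorem nearPre_mono {V : Type*} (n : ℕ) (u v : V) (i d d' : ℕ) (hd : d ≤ d')
    (p : V × V × ℕ) (h : nearPre n u v i d p) : nearPre n u v i d' p := by
  rcases h with ⟨h1, h2, h3, h4⟩ | ⟨h1, h2, h3, h4⟩ | ⟨h1, h2⟩ | ⟨h1, h2⟩
  · exact Or.inl ⟨h1, h2, by omega, by omega⟩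
  · exact Or.inr (Or.inl ⟨h1, h2, by omega, by omega⟩)
  · exact Or.inr (Or.inr (Or.inl ⟨h1, by omega⟩))
  · exact Or.inr (Or.inr (Or.inr ⟨h1, by omega⟩))

/-- The colour of a representation. -/
def colPre {V K : Type*} (m : ℕ) (L : V → V → ℕ → K) (p : V × V × ℕ) : Option K :=
  if p.2.2 = 0 ∨ p.2.2 = 2 * m + 1 then none
  else if p.2.2 ≤ m then some (L p.1 p.2.1 p.2.2) else some (L p.2.1 p.1 (2 * m + 1 - p.2.2))

theorem colPre_flip {V K : Type*} (m : ℕ) (L : V → V → ℕ → K) (a b : V) (j : ℕ)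
    (hj : j ≤ 2 * m + 1) : colPre m L (a, b, j) = colPre m L (b, a, 2 * m + 1 - j) := by
  have e : 2 * m + 1 - (2 * m + 1 - j) = j := by omega
  simp only [colPre, e]
  split_ifs <;> first | rfl | omega

theorem colPre_zero {V K : Type*} (m : ℕ) (L : V → V → ℕ → K) (a b : V) :
    colPre m L (a, b, 0) = none := by simp [colPre]

theorem colPre_low {V K : Type*} (m : ℕ) (L : V → V → ℕ → K) (a b : V) (j : ℕ)
    (h0 : 0 < j) (hj : j ≤ m) : colPre m L (a, b, j) = some (L a b j) := by
  simp only [colPre]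
  rw [if_neg (by omega), if_pos hj]

theorem colPre_respects {V K : Type*} (G : SimpleGraph V) (m : ℕ) (L : V → V → ℕ → K)
    (x y : SubdivPre G (2 * m + 1)) (h : SubdivRel G (2 * m + 1) x y) :
    colPre m L x.1 = colPre m L y.1 := by
  cases h with
  | flip a b j hab hj => exact colPre_flip m L a b j hj
  | collapse a b hab => simp [colPre]

/-- The colouring of the subdivision. -/
def colVert {V K : Type*} (G : SimpleGraph V) (m : ℕ) (L : V → V → ℕ → K) :
    SubdivVert G (2 * m + 1) → Option K :=
  Quot.lift (fun p => colPre m L p.1) (colPre_respects G m L)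

theorem col_ne_aux {V K : Type*} (G : SimpleGraph V) (m : ℕ) (L : V → V → ℕ → K)
    (hL : HalfCol G m L) (u v a b : V) (i j : ℕ)
    (hx : (u = v ∧ i = 0) ∨ (G.Adj u v ∧ i ≤ 2 * m + 1)) (hi : i ≤ m)
    (hy : (a = b ∧ j = 0) ∨ (G.Adj a b ∧ j ≤ 2 * m + 1))
    (hn : (a = u ∧ b = v ∧ i ≤ j + m ∧ j ≤ i + m) ∨ (a = u ∧ i + j ≤ m))
    (hne : (Quot.mk _ ⟨(u, v, i), hx⟩ : SubdivVert G (2 * m + 1)) ≠ Quot.mk _ ⟨(a, b, j), hy⟩) :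
    colPre m L (u, v, i) ≠ colPre m L (a, b, j) := by
  have key : ∀ (w : V) (h : (u = w ∧ 0 = 0) ∨ (G.Adj u w ∧ 0 ≤ 2 * m + 1)),
      (Quot.mk _ ⟨(u, w, 0), h⟩ : SubdivVert G (2 * m + 1)) = branchVertex G _ u := by
    intro w h
    rcases h with ⟨rfl, -⟩ | ⟨h, -⟩
    · rfl
    · exact Quot.sound (SubdivRel.collapse u w h)
  by_cases hb : a = u ∧ b = v
  · obtain ⟨rfl, rfl⟩ := hb
    have hij : i ≠ j := by rintro rfl; exact hne rfl
    have hb : i ≤ j + m ∧ j ≤ i + m := by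
      rcases hn with h | h <;> omega
    have hadj : G.Adj a b := by
      rcases hx with h | h
      · rcases hy with h' | h'
        · omega
        · exact h'.1
      · exact h.1
    rcases Nat.eq_zero_or_pos i with rfl | hi0
    · rw [colPre_zero]
      rcases le_or_gt j m with hjm | hjm
      · rw [colPre_low m L _ _ j (by omega) hjm]; simp
      · omega
    · rw [colPre_low m L _ _ i hi0 hi]
      rcases Nat.eq_zero_or_pos j with rfl | hj0
      · rw [colPre_zero]; simp
      · rcases le_or_gt j m with hjm | hjm
        · rw [colPre_low m L _ _ j hj0 hjm]
          simpa using hL.half a b hadj i j hi0 hi hj0 hjm hij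
        · rw [colPre_flip m L a b j (by omega),
            colPre_low m L _ _ (2 * m + 1 - j) (by omega) (by omega)]
          simpa using hL.edge a b hadj i (2 * m + 1 - j) hi0 hi (by omega) (by omega) (by omega)
  · have hn' : a = u ∧ i + j ≤ m := by
      rcases hn with h | h
      · exact absurd ⟨h.1, h.2.1⟩ hb
      · exact h
    obtain ⟨rfl, hij⟩ := hn'
    have hbv : v ≠ b := by rintro rfl; exact hb ⟨rfl, rfl⟩
    rcases Nat.eq_zero_or_pos i with rfl | hi0
    · rcases Nat.eq_zero_or_pos j with rfl | hj0
      · exact absurd ((key v hx).trans (key b hy).symm) hne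
      · rw [colPre_zero, colPre_low m L _ _ j hj0 (by omega)]; simp
    · rcases Nat.eq_zero_or_pos j with rfl | hj0
      · rw [colPre_zero, colPre_low m L _ _ i hi0 (by omega)]; simp
      · have h1 : G.Adj a v := by rcases hx with h | h; omega; exact h.1
        have h2 : G.Adj a b := by rcases hy with h | h; omega; exact h.1
        have := hL.star a v b h1 h2 hbv i j hi0 hj0 hij
        rw [colPre_low m L _ _ i hi0 (by omega), colPre_low m L _ _ j hj0 (by omega)]
        simpa using this

theorem col_ne_aux2 {V K : Type*} (G : SimpleGraph V) (m : ℕ) (L : V → V → ℕ → K)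
    (hL : HalfCol G m L) (u v a b : V) (i j : ℕ)
    (hx : (u = v ∧ i = 0) ∨ (G.Adj u v ∧ i ≤ 2 * m + 1)) (hi : i ≤ m)
    (hy : (a = b ∧ j = 0) ∨ (G.Adj a b ∧ j ≤ 2 * m + 1))
    (hn : nearPre (2 * m + 1) u v i m (a, b, j))
    (hne : (Quot.mk _ ⟨(u, v, i), hx⟩ : SubdivVert G (2 * m + 1)) ≠ Quot.mk _ ⟨(a, b, j), hy⟩) :
    colPre m L (u, v, i) ≠ colPre m L (a, b, j) := by
  have main : ((a = u ∧ b = v ∧ i ≤ j + m ∧ j ≤ i + m) ∨ (a = u ∧ i + j ≤ m)) ∨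
      ((b = u ∧ a = v ∧ i ≤ (2 * m + 1 - j) + m ∧ (2 * m + 1 - j) ≤ i + m) ∨
        (b = u ∧ i + (2 * m + 1 - j) ≤ m)) := by
    rcases hn with h | h | h | h
    · exact Or.inl (Or.inl h)
    · exact Or.inr (Or.inl h)
    · exact Or.inl (Or.inr h)
    · exact Or.inr (Or.inr h)
  rcases main with hn | hn
  · exact col_ne_aux G m L hL u v a b i j hx hi hy hn hne
  · rcases hy with hy | hy
    · obtain ⟨rfl, rfl⟩ := hy
      rcases hn with h | h
      · rcases hx with h' | h'
        · omega
        · exact absurd (h.1.symm.trans h.2.1) h'.1.ne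
      · omega
    · rw [colPre_flip m L a b j hy.2]
      refine col_ne_aux G m L hL u v b a i _ hx hi (Or.inr ⟨hy.1.symm, Nat.sub_le _ _⟩) hn ?_
      intro h
      exact hne (h.trans (Quot.sound (SubdivRel.flip a b j hy.1 hy.2)).symm)

theorem col_ne_walk {V K : Type*} (G : SimpleGraph V) (m : ℕ) (L : V → V → ℕ → K)
    (hL : HalfCol G m L) (x y : SubdivVert G (2 * m + 1)) (hne : x ≠ y)
    (w : (subdivision G (2 * m + 1)).Walk x y) (hw : w.length ≤ m) :
    colVert G m L x ≠ colVert G m L y := by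
  have hrep : ∃ (u v : V) (i : ℕ) (hx : (u = v ∧ i = 0) ∨ (G.Adj u v ∧ i ≤ 2 * m + 1)),
      i ≤ m ∧ x = Quot.mk _ ⟨(u, v, i), hx⟩ := by
    obtain ⟨⟨⟨u, v, i⟩, hx⟩, rfl⟩ := Quot.exists_rep x
    by_cases hi : i ≤ m
    · exact ⟨u, v, i, hx, hi, rfl⟩
    · have h : G.Adj u v ∧ i ≤ 2 * m + 1 := by
        rcases hx with ⟨-, h⟩ | h
        · simp only at h; omega
        · exact h
      exact ⟨v, u, 2 * m + 1 - i, Or.inr ⟨h.1.symm, Nat.sub_le _ _⟩, by omega,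
        Quot.sound (SubdivRel.flip u v i h.1 h.2)⟩
  obtain ⟨u, v, i, hx, hi, rfl⟩ := hrep
  obtain ⟨⟨⟨a, b, j⟩, hy⟩, rfl⟩ := Quot.exists_rep y
  have h0 : Near G m u v i 0 hi (by omega) (Quot.mk _ ⟨(u, v, i), hx⟩) :=
    Or.inl ⟨rfl, rfl, le_rfl, le_rfl⟩
  have h1 := near_walk G m u v i hi _ _ w 0 (by omega) h0
  have h2 : nearPre (2 * m + 1) u v i m (a, b, j) :=
    nearPre_mono _ _ _ _ _ _ (by omega) _ h1
  exact col_ne_aux2 G m L hL u v a b i j hx hi hy h2 hne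

theorem colorable_of_halfCol {V K : Type*} [Fintype K] (G : SimpleGraph V) (m : ℕ)
    (L : V → V → ℕ → K) (hL : HalfCol G m L) :
    (fracPower G m (2 * m + 1)).Colorable (Fintype.card K + 1) := by
  have C : (fracPower G m (2 * m + 1)).Coloring (Option K) := by
    refine SimpleGraph.Coloring.mk (colVert G m L) ?_
    intro x y h
    rw [fracPower, powerGraph, SimpleGraph.fromRel_adj] at h
    obtain ⟨hne, ⟨w, hw⟩ | ⟨w, hw⟩⟩ := h
    · exact col_ne_walk G m L hL x y hne w hw
    · exact (col_ne_walk G m L hL y x hne.symm w hw).symm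
  have := C.colorable
  rwa [Fintype.card_option] at this

theorem subdivVert_finite {V : Type*} [Finite V] (G : SimpleGraph V) (n : ℕ) :
    Finite (SubdivVert G n) := by
  have : Finite (SubdivPre G n) := by
    refine Finite.of_injective (β := V × V × Fin (n + 1))
      (fun p => (p.1.1, p.1.2.1, ⟨p.1.2.2, by rcases p.2 with h | h <;> omega⟩)) ?_
    rintro ⟨⟨a, b, i⟩, hp⟩ ⟨⟨c, d, j⟩, hq⟩ h
    simp only [Prod.mk.injEq, Fin.mk.injEq] at h
    obtain ⟨rfl, rfl, rfl⟩ := h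
    rfl
  exact Quot.finite _

theorem walk_to_branch {V : Type*} (G : SimpleGraph V) (n : ℕ) {u v : V} (h : G.Adj u v)
    (i : ℕ) (hi : i ≤ n) :
    ∃ w : (subdivision G n).Walk (mkVert G n h i hi) (branchVertex G n u), w.length ≤ i := by
  induction i with
  | zero =>
    have : mkVert G n h 0 hi = branchVertex G n u := Quot.sound (SubdivRel.collapse u v h)
    rw [this]
    exact ⟨SimpleGraph.Walk.nil, by simp⟩
  | succ i ih =>
    obtain ⟨w, hw⟩ := ih (by omega)
    by_cases he : mkVert G n h (i + 1) hi = mkVert G n h i (by omega)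
    · rw [he]; exact ⟨w, by omega⟩
    · have hadj : (subdivision G n).Adj (mkVert G n h (i + 1) hi) (mkVert G n h i (by omega)) := by
        rw [subdivision, SimpleGraph.fromRel_adj]
        exact ⟨he, Or.inr ⟨u, v, h, i, by omega, rfl, rfl⟩⟩
      exact ⟨SimpleGraph.Walk.cons hadj w, by simp; omega⟩

theorem mkVert_inj {V : Type*} (G : SimpleGraph V) (m : ℕ) {u v w : V} (h : G.Adj u v)
    (h' : G.Adj u w) (i j : ℕ) (hi : i ≤ m) (hj : j ≤ m)
    (he : mkVert G (2 * m + 1) h i (by omega) = mkVert G (2 * m + 1) h' j (by omega)) :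
    i = j ∧ (i ≠ 0 → v = w) := by
  have h0 : Near G m u v i 0 hi (by omega) (mkVert G (2 * m + 1) h i (by omega)) :=
    Or.inl ⟨rfl, rfl, le_rfl, le_rfl⟩
  rw [he] at h0
  change nearPre _ _ _ _ _ (u, w, j) at h0
  rcases h0 with ⟨h1, h2, h3, h4⟩ | ⟨h1, h2, h3, h4⟩ | ⟨h1, h2⟩ | ⟨h1, h2⟩ <;>
    simp only at h1 h2
  · simp only at h3 h4
    exact ⟨by omega, fun _ => h2.symm⟩
  · exact absurd h1.symm h'.ne
  · exact ⟨by omega, fun h => by omega⟩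
  · exact absurd h1.symm h'.ne

theorem clique_lower {V : Type*} [Fintype V] (G : SimpleGraph V) [DecidableRel G.Adj]
    (u : V) (hu : 1 ≤ G.degree u) (k : ℕ) :
    G.degree u * k + 2 ≤ (fracPower G (2 * k + 1) (2 * (2 * k + 1) + 1)).cliqueNum := by
  classical
  have := subdivVert_finite G (2 * (2 * k + 1) + 1)
  obtain ⟨w0, hw0⟩ := (G.degree_pos_iff_exists_adj u).1 hu
  let N := G.neighborFinset u
  let T := Option (Option (N × Fin k))
  let W : T → {w // G.Adj u w} := fun t => match t with
    | none => ⟨w0, hw0⟩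
    | some none => ⟨w0, hw0⟩
    | some (some (w, _)) => ⟨w.1, (G.mem_neighborFinset u w.1).1 w.2⟩
  let l : T → ℕ := fun t => match t with
    | none => 0
    | some none => k + 1
    | some (some (_, i)) => i.1 + 1
  have hl : ∀ t, l t ≤ k + 1 := by
    rintro (_ | _ | ⟨w, i⟩) <;> simp only [l] <;> omega
  let F : T → SubdivVert G (2 * (2 * k + 1) + 1) := fun t =>
    mkVert G _ (W t).2 (l t) (by have := hl t; omega)
  have hF : ∀ t t', F t = F t' → l t = l t' ∧ (l t ≠ 0 → (W t).1 = (W t').1) := by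
    intro t t' h
    exact mkVert_inj G (2 * k + 1) (W t).2 (W t').2 (l t) (l t')
      (by have := hl t; omega) (by have := hl t'; omega) h
  have hinj : Function.Injective F := by
    intro t t' h
    obtain ⟨h1, h2⟩ := hF t t' h
    rcases t with (_ | _ | ⟨⟨w, hw⟩, i, hi⟩) <;> rcases t' with (_ | _ | ⟨⟨w', hw'⟩, i', hi'⟩) <;>
      simp only [l, W] at h1 h2 <;> first | rfl | omega | skip
    have : i = i' := by omega
    have h3 := h2 (by omega)
    subst this
    subst h3
    rfl
  have hsum : ∀ t t', t ≠ t' → l t + l t' ≤ 2 * k + 1 := by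
    intro t t' h
    rcases t with (_ | _ | ⟨⟨w, hw⟩, i, hi⟩) <;> rcases t' with (_ | _ | ⟨⟨w', hw'⟩, i', hi'⟩) <;>
      simp only [l] <;> first | omega | exact absurd rfl h
  have hcl : (fracPower G (2 * k + 1) (2 * (2 * k + 1) + 1)).IsClique
      ((Finset.univ.image F : Finset _) : Set (SubdivVert G (2 * (2 * k + 1) + 1))) := by
    intro x hx y hy hxy
    simp only [Finset.coe_image, Finset.coe_univ, Set.image_univ, Set.mem_range] at hx hy
    obtain ⟨t, rfl⟩ := hx
    obtain ⟨t', rfl⟩ := hy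
    rw [fracPower, powerGraph, SimpleGraph.fromRel_adj]
    refine ⟨hxy, Or.inl ?_⟩
    obtain ⟨p, hp⟩ := walk_to_branch G (2 * (2 * k + 1) + 1) (W t).2 (l t) (by have := hl t; omega)
    obtain ⟨q, hq⟩ := walk_to_branch G (2 * (2 * k + 1) + 1) (W t').2 (l t') (by have := hl t'; omega)
    refine ⟨p.append q.reverse, ?_⟩
    have := hsum t t' (fun h => hxy (by rw [h]))
    rw [SimpleGraph.Walk.length_append, SimpleGraph.Walk.length_reverse]
    omega
  have hcard := hcl.card_le_cliqueNum
  rw [Finset.card_image_of_injective _ hinj] at hcard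
  have hT : Fintype.card T = G.degree u * k + 2 := by
    simp only [T, Fintype.card_option, Fintype.card_prod, Fintype.card_coe, Fintype.card_fin, N,
      SimpleGraph.card_neighborFinset_eq_degree]
  rwa [Finset.card_univ, hT] at hcard

theorem sym_choice {V α : Type*} [Finite V] (G : SimpleGraph V) (P : V → V → α → α → Prop)
    [Nonempty α]
    (hs : ∀ u v X Y, P u v X Y → P v u Y X)
    (he : ∀ u v, G.Adj u v → ∃ X Y, P u v X Y) :
    ∃ F : V → V → α, ∀ u v, G.Adj u v → P u v (F u v) (F v u) := by
  classical
  obtain ⟨n, ⟨e⟩⟩ := Finite.exists_equiv_fin V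
  have he' : ∀ u v, ∃ X Y, G.Adj u v → P u v X Y := by
    intro u v
    by_cases h : G.Adj u v
    · obtain ⟨X, Y, hXY⟩ := he u v h
      exact ⟨X, Y, fun _ => hXY⟩
    · exact ⟨Classical.arbitrary α, Classical.arbitrary α, fun h' => absurd h' h⟩
  choose X Y h using he'
  refine ⟨fun u v => if e u < e v then X u v else Y v u, ?_⟩
  intro u v huv
  have hne : e u ≠ e v := fun h => huv.ne (e.injective h)
  rcases lt_or_gt_of_ne hne with hlt | hlt
  · simp only [if_pos hlt, if_neg (not_lt_of_gt hlt)]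
    exact h u v huv
  · simp only [if_pos hlt, if_neg (not_lt_of_gt hlt)]
    exact hs _ _ _ _ (h v u huv.symm)

/-- The main colouring: the inner level `p + 1` at `u` on `uv` has colour `(c u v, σ u p)`, the
dual outer level `2 k + 1 - p` has colour `(X u v (σ u p), σ u p)`. -/
def mainL {V : Type*} (D k : ℕ) (c : V → V → Fin D) (σ : V → Equiv.Perm (Fin k))
    (X : V → V → Fin k → Fin D) (o : V → V → Bool) (u v : V) (i : ℕ) : (Fin D × Fin k) ⊕ Bool :=
  if h : 1 ≤ i ∧ i ≤ k then Sum.inl (c u v, σ u ⟨i - 1, by omega⟩)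
  else if h : k + 2 ≤ i ∧ i ≤ 2 * k + 1 then
    Sum.inl (X u v (σ u ⟨2 * k + 1 - i, by omega⟩), σ u ⟨2 * k + 1 - i, by omega⟩)
  else Sum.inr (o u v)

theorem mainL_cases {V : Type*} (D k : ℕ) (c : V → V → Fin D) (σ : V → Equiv.Perm (Fin k))
    (X : V → V → Fin k → Fin D) (o : V → V → Bool) (u v : V) (i : ℕ) (h1 : 1 ≤ i)
    (h2 : i ≤ 2 * k + 1) :
    (∃ p : Fin k, i = p.1 + 1 ∧ mainL D k c σ X o u v i = Sum.inl (c u v, σ u p)) ∨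
    (∃ p : Fin k, i = 2 * k + 1 - p.1 ∧
      mainL D k c σ X o u v i = Sum.inl (X u v (σ u p), σ u p)) ∨
    (i = k + 1 ∧ mainL D k c σ X o u v i = Sum.inr (o u v)) := by
  unfold mainL
  by_cases ha : 1 ≤ i ∧ i ≤ k
  · left
    refine ⟨⟨i - 1, by omega⟩, by simp only; omega, ?_⟩
    rw [dif_pos ha]
  · right
    by_cases hb : k + 2 ≤ i ∧ i ≤ 2 * k + 1
    · left
      refine ⟨⟨2 * k + 1 - i, by omega⟩, by simp only; omega, ?_⟩
      rw [dif_neg ha, dif_pos hb]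
    · right
      refine ⟨by omega, ?_⟩
      rw [dif_neg ha, dif_neg hb]

theorem mainL_halfCol {V : Type*} (G : SimpleGraph V) (D k : ℕ) (c : V → V → Fin D)
    (σ : V → Equiv.Perm (Fin k))
    (X : V → V → Fin k → Fin D) (o : V → V → Bool)
    (hc : ∀ u v w, G.Adj u v → G.Adj u w → c u v = c u w → v = w)
    (ho : ∀ u v, G.Adj u v → o u v ≠ o v u)
    (hX : ∀ u v, G.Adj u v → ∀ t, X u v t ≠ c u v ∧ X u v t ≠ X v u t ∧
      (X u v t = c v u → ((σ v).symm t).1 < ((σ u).symm t).1)) :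
    HalfCol G (2 * k + 1) (mainL D k c σ X o) := by
  constructor
  · intro u v w huv huw hvw i j hi hj hij h
    rcases mainL_cases D k c σ X o u v i hi (by omega) with ⟨p, hp, e⟩ | ⟨p, hp, e⟩ | ⟨hp, e⟩ <;>
    rcases mainL_cases D k c σ X o u w j hj (by omega) with ⟨q, hq, e'⟩ | ⟨q, hq, e'⟩ | ⟨hq, e'⟩ <;>
    rw [e, e'] at h <;>
    simp only [Sum.inl.injEq, Sum.inr.injEq, Prod.mk.injEq, EmbeddingLike.apply_eq_iff_eq,
      reduceCtorEq] at h <;>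
    first
      | omega
      | exact hvw (hc u v w huv huw h.1)
      | (have := congrArg Fin.val h.2; omega)
  · intro u v huv i j hi him hj hjm hij h
    rcases mainL_cases D k c σ X o u v i hi (by omega) with ⟨p, hp, e⟩ | ⟨p, hp, e⟩ | ⟨hp, e⟩ <;>
    rcases mainL_cases D k c σ X o u v j hj (by omega) with ⟨q, hq, e'⟩ | ⟨q, hq, e'⟩ | ⟨hq, e'⟩ <;>
    rw [e, e'] at h <;>
    simp only [Sum.inl.injEq, Sum.inr.injEq, Prod.mk.injEq, EmbeddingLike.apply_eq_iff_eq,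
      reduceCtorEq] at h <;>
    first
      | omega
      | exact (hX u v huv _).1 h.1
      | exact (hX u v huv _).1 h.1.symm
      | (have := congrArg Fin.val h.2; omega)
  · intro u v huv i j hi him hj hjm hij h
    rcases mainL_cases D k c σ X o u v i hi (by omega) with ⟨p, hp, e⟩ | ⟨p, hp, e⟩ | ⟨hp, e⟩ <;>
    rcases mainL_cases D k c σ X o v u j hj (by omega) with ⟨q, hq, e'⟩ | ⟨q, hq, e'⟩ | ⟨hq, e'⟩ <;>
    rw [e, e'] at h <;>
    simp only [Sum.inl.injEq, Prod.mk.injEq, Sum.inr.injEq, reduceCtorEq] at h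
    · omega
    · obtain ⟨h1, h2⟩ := h
      have := (hX v u huv.symm (σ v q)).2.2 h1.symm
      rw [← h2] at this
      simp only [Equiv.symm_apply_apply] at this
      rw [h2, Equiv.symm_apply_apply] at this
      omega
    · obtain ⟨h1, h2⟩ := h
      have := (hX u v huv (σ u p)).2.2 h1
      rw [Equiv.symm_apply_apply, h2, Equiv.symm_apply_apply] at this
      omega
    · obtain ⟨h1, h2⟩ := h
      rw [h2] at h1
      exact (hX u v huv (σ v q)).2.1 h1
    · exact ho u v huv h

theorem exists_halfEdge {V : Type*} [Fintype V] (G : SimpleGraph V) [DecidableRel G.Adj]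
    (D : ℕ) [NeZero D] (hD : ∀ u, G.degree u ≤ D) (M : V → V → Prop)
    (hM : ∀ u v w, G.Adj u v → G.Adj u w → M u v → M u w → v = w) :
    ∃ c : V → V → Fin D, (∀ u v w, G.Adj u v → G.Adj u w → c u v = c u w → v = w) ∧
      ∀ u v, G.Adj u v → M u v → c u v = 0 := by
  classical
  have : ∀ u, ∃ f : V → Fin D, (∀ v w, G.Adj u v → G.Adj u w → f v = f w → v = w) ∧
      ∀ v, G.Adj u v → M u v → f v = 0 := by
    intro u
    have hcard : Fintype.card (G.neighborFinset u) ≤ Fintype.card (Fin D) := by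
      rw [Fintype.card_coe, Fintype.card_fin, SimpleGraph.card_neighborFinset_eq_degree]
      exact hD u
    obtain ⟨g⟩ := Function.Embedding.nonempty_of_card_le hcard
    let f0 : V → Fin D := fun v => if h : v ∈ G.neighborFinset u then g ⟨v, h⟩ else 0
    have hf0 : ∀ v w, G.Adj u v → G.Adj u w → f0 v = f0 w → v = w := by
      intro v w hv hw h
      have hv' := (G.mem_neighborFinset u v).2 hv
      have hw' := (G.mem_neighborFinset u w).2 hw
      simp only [f0, dif_pos hv', dif_pos hw'] at h
      exact congrArg Subtype.val (g.injective h)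
    by_cases hex : ∃ w, G.Adj u w ∧ M u w
    · obtain ⟨w, hw, hMw⟩ := hex
      refine ⟨fun v => Equiv.swap (f0 w) 0 (f0 v), ?_, ?_⟩
      · intro a b ha hb h
        exact hf0 a b ha hb ((Equiv.swap (f0 w) 0).injective h)
      · intro v hv hMv
        rw [hM u v w hv hw hMv hMw]
        exact Equiv.swap_apply_left _ _
    · exact ⟨f0, hf0, fun v hv hMv => absurd ⟨v, hv, hMv⟩ hex⟩
  choose c h1 h2 using this
  exact ⟨c, h1, h2⟩

theorem exists_cut {V : Type*} [Fintype V] (G : SimpleGraph V) [DecidableRel G.Adj]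
    (hD : ∀ u, G.degree u ≤ 3) :
    ∃ x : V → Bool, ∀ u v w, G.Adj u v → G.Adj u w → x v = x u → x w = x u → v = w := by
  classical
  let s : Bool → ℤ := fun b => if b then 1 else -1
  let E : (V → Bool) → ℤ := fun x => ∑ a, ∑ b, if G.Adj a b then s (x a) * s (x b) else 0
  obtain ⟨x, -, hx⟩ := Finset.exists_min_image (Finset.univ : Finset (V → Bool)) E
    ⟨fun _ => true, Finset.mem_univ _⟩
  refine ⟨x, ?_⟩
  intro u v w huv huw hv hw
  by_contra hvw
  let y : V → Bool := Function.update x u (!x u)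
  have hss : ∀ b, s (!b) = - s b := by intro b; cases b <;> simp [s]
  have hyu : s (y u) = - s (x u) := by simp [y, hss]
  have hya : ∀ a, a ≠ u → y a = x a := fun a ha => by simp [y, ha]
  -- energy split at u
  have split : ∀ z : V → Bool, E z =
      (∑ a ∈ Finset.univ.erase u, ∑ b ∈ Finset.univ.erase u,
        if G.Adj a b then s (z a) * s (z b) else 0) +
      2 * (s (z u) * ∑ b ∈ Finset.univ.erase u, if G.Adj u b then s (z b) else 0) := by
    intro z
    have hin : ∀ a, (∑ b, if G.Adj a b then s (z a) * s (z b) else 0) =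
        (if G.Adj a u then s (z a) * s (z u) else 0) +
          ∑ b ∈ Finset.univ.erase u, if G.Adj a b then s (z a) * s (z b) else 0 :=
      fun a => (Finset.add_sum_erase _ _ (Finset.mem_univ u)).symm
    simp only [E]
    rw [← Finset.add_sum_erase _ _ (Finset.mem_univ u), hin u]
    rw [Finset.sum_congr rfl (fun a _ => hin a), Finset.sum_add_distrib]
    have e1 : (∑ b ∈ Finset.univ.erase u, if G.Adj u b then s (z u) * s (z b) else 0) =
        s (z u) * ∑ b ∈ Finset.univ.erase u, if G.Adj u b then s (z b) else 0 := by
      rw [Finset.mul_sum]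
      exact Finset.sum_congr rfl (fun b _ => by split_ifs <;> simp)
    have e2 : (∑ b ∈ Finset.univ.erase u, if G.Adj b u then s (z b) * s (z u) else 0) =
        s (z u) * ∑ b ∈ Finset.univ.erase u, if G.Adj u b then s (z b) else 0 := by
      rw [Finset.mul_sum]
      refine Finset.sum_congr rfl (fun b _ => ?_)
      by_cases hb : G.Adj u b
      · rw [if_pos hb, if_pos hb.symm, mul_comm]
      · rw [if_neg hb, if_neg (fun h => hb h.symm), mul_zero]
    rw [e1, e2, if_neg (G.loopless.irrefl u)]
    ring
  have hle := hx y (Finset.mem_univ _)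
  rw [split x, split y, hyu] at hle
  have r1 : (∑ a ∈ Finset.univ.erase u, ∑ b ∈ Finset.univ.erase u,
        if G.Adj a b then s (y a) * s (y b) else 0) = ∑ a ∈ Finset.univ.erase u,
        ∑ b ∈ Finset.univ.erase u, if G.Adj a b then s (x a) * s (x b) else 0 := by
    refine Finset.sum_congr rfl (fun a ha => Finset.sum_congr rfl (fun b hb => ?_))
    rw [hya a (Finset.ne_of_mem_erase ha), hya b (Finset.ne_of_mem_erase hb)]
  have r2 : (∑ b ∈ Finset.univ.erase u, if G.Adj u b then s (y b) else 0) =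
      ∑ b ∈ Finset.univ.erase u, if G.Adj u b then s (x b) else 0 := by
    refine Finset.sum_congr rfl (fun b hb => ?_)
    rw [hya b (Finset.ne_of_mem_erase hb)]
  rw [r1, r2] at hle
  have hle2 : s (x u) * ∑ b ∈ Finset.univ.erase u, (if G.Adj u b then s (x b) else 0) ≤ 0 := by
    linarith
  have r3 : s (x u) * ∑ b ∈ Finset.univ.erase u, (if G.Adj u b then s (x b) else 0) =
      ∑ b ∈ G.neighborFinset u, s (x u) * s (x b) := by
    rw [← Finset.mul_sum]
    congr 1
    rw [← Finset.sum_filter]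
    refine Finset.sum_congr ?_ (fun _ _ => rfl)
    ext b
    simp only [Finset.mem_filter, Finset.mem_erase, Finset.mem_univ, and_true,
      SimpleGraph.mem_neighborFinset]
    exact ⟨fun h => h.2, fun h => ⟨h.ne', h⟩⟩
  rw [r3] at hle2
  have hsq : ∀ b, s b * s b = 1 := by intro b; cases b <;> simp [s]
  have hlb : ∀ b c, -1 ≤ s b * s c := by intro b c; cases b <;> cases c <;> simp [s]
  have hvm : v ∈ G.neighborFinset u := (G.mem_neighborFinset u v).2 huv
  have hwm : w ∈ (G.neighborFinset u).erase v :=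
    Finset.mem_erase.2 ⟨fun h => hvw h.symm, (G.mem_neighborFinset u w).2 huw⟩
  rw [← Finset.add_sum_erase _ _ hvm, ← Finset.add_sum_erase _ _ hwm, hv, hw, hsq] at hle2
  have hrest : -((((G.neighborFinset u).erase v).erase w).card : ℤ) ≤
      ∑ b ∈ ((G.neighborFinset u).erase v).erase w, s (x u) * s (x b) := by
    have := Finset.card_nsmul_le_sum (((G.neighborFinset u).erase v).erase w)
      (fun b => s (x u) * s (x b)) (-1) (fun b _ => hlb _ _)
    simpa using this
  have hcd : (((G.neighborFinset u).erase v).erase w).card ≤ 1 := by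
    rw [Finset.card_erase_of_mem hwm, Finset.card_erase_of_mem hvm,
      SimpleGraph.card_neighborFinset_eq_degree]
    have := hD u
    omega
  omega

theorem exists_orient {V : Type*} [Finite V] (G : SimpleGraph V) :
    ∃ o : V → V → Bool, ∀ u v, G.Adj u v → o u v ≠ o v u :=
  sym_choice G (fun _ _ a b => a ≠ b) (fun _ _ _ _ h => h.symm)
    (fun _ _ _ => ⟨true, false, by simp⟩)

theorem colorable_of_main {V : Type*} [Finite V] (G : SimpleGraph V) (D k : ℕ) [NeZero D]
    (c : V → V → Fin D) (σ : V → Equiv.Perm (Fin k))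
    (hc : ∀ u v w, G.Adj u v → G.Adj u w → c u v = c u w → v = w)
    (hex : ∀ u v, G.Adj u v → ∀ t, ∃ X Y : Fin D, X ≠ c u v ∧ Y ≠ c v u ∧ X ≠ Y ∧
      (X = c v u → ((σ v).symm t).1 < ((σ u).symm t).1) ∧
      (Y = c u v → ((σ u).symm t).1 < ((σ v).symm t).1)) :
    (fracPower G (2 * k + 1) (2 * (2 * k + 1) + 1)).Colorable (D * k + 2 + 1) := by
  obtain ⟨o, ho⟩ := exists_orient G
  obtain ⟨X, hX⟩ := sym_choice G (α := Fin k → Fin D) (fun u v X Y => ∀ t,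
      X t ≠ c u v ∧ Y t ≠ c v u ∧ X t ≠ Y t ∧
      (X t = c v u → ((σ v).symm t).1 < ((σ u).symm t).1) ∧
      (Y t = c u v → ((σ u).symm t).1 < ((σ v).symm t).1))
    (fun u v X Y h t => ⟨(h t).2.1, (h t).1, (h t).2.2.1.symm, (h t).2.2.2.2, (h t).2.2.2.1⟩)
    (fun u v huv => by
      choose X Y h using hex u v huv
      exact ⟨X, Y, h⟩)
  have := colorable_of_halfCol G (2 * k + 1) _ (mainL_halfCol G D k c σ X o hc ho
    (fun u v huv t => ⟨(hX u v huv t).1, (hX u v huv t).2.2.1, (hX u v huv t).2.2.2.1⟩))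
  simpa using this

theorem colorable_four {V : Type*} [Fintype V] (G : SimpleGraph V) [DecidableRel G.Adj]
    (D k : ℕ) (hD4 : 4 ≤ D) (hD : ∀ u, G.degree u ≤ D) :
    (fracPower G (2 * k + 1) (2 * (2 * k + 1) + 1)).Colorable (D * k + 2 + 1) := by
  have : NeZero D := ⟨by omega⟩
  obtain ⟨c, hc, -⟩ := exists_halfEdge G D hD (fun _ _ => False) (by simp)
  refine colorable_of_main G D k c (fun _ => Equiv.refl _) hc ?_
  intro u v _ t
  have ex : ∀ s : Finset (Fin D), s.card ≤ 3 → ∃ a, a ∉ s := by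
    intro s hs
    by_contra hcon
    push Not at hcon
    have h1 : s = Finset.univ := Finset.eq_univ_iff_forall.2 hcon
    rw [h1, Finset.card_univ, Fintype.card_fin] at hs
    omega
  obtain ⟨X, hX⟩ := ex {c u v, c v u} (Finset.card_le_two.trans (by omega))
  obtain ⟨Y, hY⟩ := ex {c u v, c v u, X} Finset.card_le_three
  simp only [Finset.mem_insert, Finset.mem_singleton, not_or] at hX hY
  exact ⟨X, Y, hX.1, hY.2.1, fun h => hY.2.2 h.symm, fun h => absurd h hX.2,
    fun h => absurd h hY.1⟩

theorem fin3_third (A B : Fin 3) : ∃ C, C ≠ A ∧ C ≠ B := by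
  revert A B; decide

theorem fin3_two (A : Fin 3) : ∃ X Y : Fin 3, X ≠ A ∧ Y ≠ A ∧ X ≠ Y := by
  revert A; decide

theorem colorable_three {V : Type*} [Fintype V] (G : SimpleGraph V) [DecidableRel G.Adj]
    (k : ℕ) (hk : 2 ≤ k) (hD : ∀ u, G.degree u ≤ 3) :
    (fracPower G (2 * k + 1) (2 * (2 * k + 1) + 1)).Colorable (3 * k + 2 + 1) := by
  obtain ⟨x, hx⟩ := exists_cut G hD
  obtain ⟨c, hc, hc0⟩ := exists_halfEdge G 3 hD (fun u v => x v = x u) hx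
  obtain ⟨l, rfl⟩ : ∃ l, k = l + 2 := ⟨k - 2, by omega⟩
  refine colorable_of_main G 3 (l + 2) c
    (fun u => if x u then finRotate (l + 2) else Equiv.refl _) hc ?_
  intro u v huv t
  by_cases hAB : c u v = c v u
  · obtain ⟨X, Y, h1, h2, h3⟩ := fin3_two (c u v)
    exact ⟨X, Y, h1, hAB ▸ h2, h3, fun h => absurd (h.trans hAB.symm) h1,
      fun h => absurd h h2⟩
  · have hxuv : x u ≠ x v := by
      intro h
      apply hAB
      rw [hc0 u v huv h.symm, hc0 v u huv.symm h]
    have hrot : (finRotate (l + 2)).symm t ≠ t := by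
      intro h
      rw [Equiv.symm_apply_eq, finRotate_apply] at h
      simp at h
    have hpq : ((if x u then finRotate (l + 2) else Equiv.refl _).symm t).1 ≠
        ((if x v then finRotate (l + 2) else Equiv.refl _).symm t).1 := by
      intro h
      have h := Fin.ext h
      cases hu : x u <;> cases hv : x v <;> rw [hu, hv] at h hxuv
      · exact hxuv rfl
      · exact hrot h.symm
      · exact hrot h
      · exact hxuv rfl
    obtain ⟨C, hCA, hCB⟩ := fin3_third (c u v) (c v u)
    rcases lt_or_gt_of_ne hpq with hlt | hlt
    · exact ⟨C, c u v, hCA, hAB, hCA, fun h => absurd h hCB, fun _ => hlt⟩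
    · exact ⟨c v u, C, fun h => hAB h.symm, hCB, hCB.symm, fun _ => hlt, fun h => absurd h hCA⟩

/-- The first-level colours in the cubic case with `m = 3`. -/
def lev1 (s : Bool) (A : Fin 3) : Fin 5 :=
  if A = 0 then 0 else if A = 1 then (if s then 3 else 1) else (if s then 4 else 2)

theorem lev1_inj : ∀ s A B, lev1 s A = lev1 s B → A = B := by decide

/-- The condition on levels two and three of an edge. -/
def edgeOK (s t : Bool) (A B : Fin 3) (U V : Fin 5 × Fin 5) : Prop :=
  ((∀ C, U.1 ≠ lev1 s C) ∧ U.2 ≠ lev1 s A ∧ U.1 ≠ U.2 ∧ U.2 ≠ lev1 t B) ∧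
  ((∀ C, V.1 ≠ lev1 t C) ∧ V.2 ≠ lev1 t B ∧ V.1 ≠ V.2 ∧ V.2 ≠ lev1 s A) ∧
  (U.1 ≠ V.1 ∧ U.2 ≠ V.2 ∧ U.1 ≠ V.2 ∧ U.2 ≠ V.1)

instance (s t : Bool) (A B : Fin 3) (U V : Fin 5 × Fin 5) : Decidable (edgeOK s t A B U V) := by
  unfold edgeOK; infer_instance

set_option maxRecDepth 100000 in
theorem edgeOK_exists : ∀ s t A B, (s = t → A = 0 ∧ B = 0) → ∃ U V, edgeOK s t A B U V := by
  decide

theorem edgeOK_symm (s t : Bool) (A B : Fin 3) (U V : Fin 5 × Fin 5) (h : edgeOK s t A B U V) :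
    edgeOK t s B A V U :=
  ⟨h.2.1, h.1, h.2.2.1.symm, h.2.2.2.1.symm, h.2.2.2.2.2.symm, h.2.2.2.2.1.symm⟩

theorem colorable_three_one {V : Type*} [Fintype V] (G : SimpleGraph V) [DecidableRel G.Adj]
    (hD : ∀ u, G.degree u ≤ 3) :
    (fracPower G 3 (2 * 3 + 1)).Colorable (5 + 1) := by
  obtain ⟨x, hx⟩ := exists_cut G hD
  obtain ⟨c, hc, hc0⟩ := exists_halfEdge G 3 hD (fun u v => x v = x u) hx
  obtain ⟨F, hF⟩ := sym_choice G (fun u v U W => edgeOK (x u) (x v) (c u v) (c v u) U W)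
    (fun u v X Y h => edgeOK_symm _ _ _ _ _ _ h)
    (fun u v huv => edgeOK_exists _ _ _ _
      (fun h => ⟨hc0 u v huv h.symm, hc0 v u huv.symm h⟩))
  let L : V → V → ℕ → Fin 5 := fun u v i =>
    if i = 1 then lev1 (x u) (c u v) else if i = 2 then (F u v).1 else (F u v).2
  have hL : HalfCol G 3 L := by
    constructor
    · intro u v w huv huw hvw i j hi hj hij
      have h1 := (hF u v huv).1.1
      have h2 := (hF u w huw).1.1
      have : (i = 1 ∧ j = 1) ∨ (i = 1 ∧ j = 2) ∨ (i = 2 ∧ j = 1) := by omega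
      rcases this with ⟨rfl, rfl⟩ | ⟨rfl, rfl⟩ | ⟨rfl, rfl⟩
      · intro h
        exact hvw (hc u v w huv huw (lev1_inj _ _ _ h))
      · exact (h2 _).symm
      · exact h1 _
    · intro u v huv i j hi him hj hjm hij
      obtain ⟨⟨h1, h2, h3, -⟩, -⟩ := hF u v huv
      have h1 := h1 (c u v)
      interval_cases i <;> interval_cases j <;> simp [L] at hij ⊢ <;>
        first | assumption | (apply Ne.symm; assumption)
    · intro u v huv i j hi him hj hjm hij
      obtain ⟨⟨h1, h2, h3, h4⟩, ⟨g1, g2, g3, g4⟩, e1, e2, e3, e4⟩ := hF u v huv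
      interval_cases i <;> interval_cases j <;> simp [L] at hij ⊢ <;>
        first | assumption | (apply Ne.symm; assumption)
  have := colorable_of_halfCol G 3 L hL
  simpa using this

theorem chromatic_le_clique_add_one_of_odd_top {V : Type*} [Fintype V] (G : SimpleGraph V)
    [DecidableRel G.Adj] (hnc : G ≠ ⊤) (hΔ : 3 ≤ G.maxDegree)
    (m : ℕ) (hm : Odd m) (hm3 : 3 ≤ m) :
    (fracPower G m (2 * m + 1)).chromaticNumber ≤
      (((fracPower G m (2 * m + 1)).cliqueNum + 1 : ℕ) : ℕ∞) := by
  have hne : Nonempty V := by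
    by_contra h
    rw [not_nonempty_iff] at h
    simp at hΔ
  obtain ⟨k, rfl⟩ := hm
  have hk : 1 ≤ k := by omega
  obtain ⟨u, hu⟩ := G.exists_maximal_degree_vertex
  have hcl := clique_lower G u (by omega) k
  rw [← hu] at hcl
  have hdeg : ∀ v, G.degree v ≤ G.maxDegree := G.degree_le_maxDegree
  have hcol : (fracPower G (2 * k + 1) (2 * (2 * k + 1) + 1)).Colorable
      (G.maxDegree * k + 2 + 1) := by
    generalize G.maxDegree = D at *
    rcases Nat.lt_or_ge D 4 with h | h
    · obtain rfl : D = 3 := by omega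
      rcases Nat.lt_or_ge k 2 with h' | h'
      · obtain rfl : k = 1 := by omega
        exact colorable_three_one G hdeg
      · exact colorable_three G k h' hdeg
    · exact colorable_four G D k h hdeg
  have h1 := hcol.chromaticNumber_le
  refine h1.trans ?_
  exact_mod_cast Nat.succ_le_succ hcl
end

section
/- For every integer r ≥ 4, the complete graph K_r satisfies χ((K_r)^{3/5}) = ω((K_r)^{3/5}) = r + 1. -/
open SimpleGraph

inductive KN (r : ℕ) where
  | br (u : Fin r) | one (u v : Fin r) | two (u v : Fin r)

def KNf {r : ℕ} : Fin r × Fin r × ℕ → KN r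
  | (u, _, 0) => .br u
  | (u, v, 1) => .one u v
  | (u, v, 2) => .two u v
  | (u, v, 3) => .two v u
  | (u, v, 4) => .one v u
  | (_, v, _) => .br v

abbrev KV (r : ℕ) := SubdivVert (⊤ : SimpleGraph (Fin r)) 5

def KNF {r : ℕ} : KV r → KN r :=
  Quot.lift (fun p => KNf p.1) (by
    intro a b h
    induction h with
    | flip u v i h hi =>
      interval_cases i <;> rfl
    | collapse u v h => rfl)

/-- A section of the normal form map. -/
noncomputable def KNG {r : ℕ} : KN r → KV r := by
  classical
  exact fun p => match p with
  | .br u => branchVertex _ _ u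
  | .one u v => if h : u ≠ v then mkVert (⊤ : SimpleGraph (Fin r)) 5 (u := u) (v := v) h 1 (by omega)
      else branchVertex _ _ u
  | .two u v => if h : u ≠ v then mkVert (⊤ : SimpleGraph (Fin r)) 5 (u := u) (v := v) h 2 (by omega)
      else branchVertex _ _ u

lemma mk_flip {r : ℕ} {u v : Fin r} (h : (⊤ : SimpleGraph (Fin r)).Adj u v) (i : ℕ) (hi : i ≤ 5) :
    mkVert (⊤ : SimpleGraph (Fin r)) 5 h i hi
      = mkVert (⊤ : SimpleGraph (Fin r)) 5 h.symm (5 - i) (by omega) :=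
  Quot.sound (SubdivRel.flip u v i h hi)

lemma mk_zero {r : ℕ} {u v : Fin r} (h : (⊤ : SimpleGraph (Fin r)).Adj u v) :
    mkVert (⊤ : SimpleGraph (Fin r)) 5 h 0 (by omega) = branchVertex _ _ u :=
  Quot.sound (SubdivRel.collapse u v h)

lemma KNG_KNF {r : ℕ} (x : KV r) : KNG (KNF x) = x := by
  induction x using Quot.ind with
  | mk p =>
    obtain ⟨⟨u, v, i⟩, h⟩ := p
    rcases h with ⟨h1, h2⟩ | ⟨h, hi⟩
    · simp only at h1 h2
      subst h1; subst h2
      rfl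
    · simp only at h hi
      change _ = mkVert (⊤ : SimpleGraph (Fin r)) 5 h i hi
      have hne : u ≠ v := h
      change KNG (KNf (u, v, i)) = _
      interval_cases i
      · exact (mk_zero h).symm
      · simp [KNf, KNG, hne]
      · simp [KNf, KNG, hne]
      · rw [mk_flip]; simp [KNf, KNG, hne.symm]
      · rw [mk_flip]; simp [KNf, KNG, hne.symm]
      · rw [mk_flip]; exact (mk_zero h.symm).symm

lemma KNF_inj {r : ℕ} : Function.Injective (KNF (r := r)) :=
  Function.LeftInverse.injective KNG_KNF

inductive KR {r : ℕ} : KN r → KN r → Prop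
  | a (u v : Fin r) (h : u ≠ v) : KR (.br u) (.one u v)
  | a2 (u v : Fin r) (h : u ≠ v) : KR (.one u v) (.br u)
  | b (u v : Fin r) (h : u ≠ v) : KR (.one u v) (.two u v)
  | b2 (u v : Fin r) (h : u ≠ v) : KR (.two u v) (.one u v)
  | c (u v : Fin r) (h : u ≠ v) : KR (.two u v) (.two v u)

lemma KR_symm {r : ℕ} {p q : KN r} (h : KR p q) : KR q p := by
  cases h with
  | a u v h => exact .a2 u v h
  | a2 u v h => exact .a u v h
  | b u v h => exact .b2 u v h
  | b2 u v h => exact .b u v h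
  | c u v h => exact .c v u h.symm

lemma KR_mk {r : ℕ} {u v : Fin r} (h : (⊤ : SimpleGraph (Fin r)).Adj u v) (i : ℕ) (hi : i < 5) :
    KR (KNF (mkVert _ 5 h i hi.le)) (KNF (mkVert _ 5 h (i+1) hi)) := by
  have hne : u ≠ v := h
  change KR (KNf (u, v, i)) (KNf (u, v, i + 1))
  interval_cases i
  · exact .a u v hne
  · exact .b u v hne
  · exact .c u v hne
  · exact .b2 v u hne.symm
  · exact .a2 v u hne.symm

lemma KR_adj {r : ℕ} {x y : KV r} (h : (subdivision (⊤ : SimpleGraph (Fin r)) 5).Adj x y) :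
    KR (KNF x) (KNF y) := by
  rw [subdivision, SimpleGraph.fromRel_adj] at h
  obtain ⟨-, ⟨u, v, h, i, hi, rfl, rfl⟩ | ⟨u, v, h, i, hi, rfl, rfl⟩⟩ := h
  · exact KR_mk h i hi
  · exact KR_symm (KR_mk h i hi)

def KC {r : ℕ} (a : Fin r → Fin r → Fin r) : KN r → Option (Fin r)
  | .br _ => none
  | .one u v => some (a u v)
  | .two u _ => some u

structure KGood {r : ℕ} (a : Fin r → Fin r → Fin r) : Prop where
  inj : ∀ u v w, a u v = a u w → v = w
  idem : ∀ u, a u u = u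
  ne : ∀ u v, u ≠ v → a u v ≠ v
  anti : ∀ u v, u ≠ v → a u v ≠ a v u

lemma KGood.ne2 {r : ℕ} {a : Fin r → Fin r → Fin r} (h : KGood a) (u v : Fin r) (huv : u ≠ v) :
    a u v ≠ u := fun e => huv (h.inj u u v (by rw [e, h.idem]))

lemma KC1 {r : ℕ} {a : Fin r → Fin r → Fin r} (ha : KGood a) {p q : KN r}
    (h1 : KR p q) : KC a p ≠ KC a q := by
  have h3 := ha.ne2
  cases h1 <;> simp [KC] <;> grind

lemma KC2 {r : ℕ} {a : Fin r → Fin r → Fin r} (ha : KGood a) {p q s : KN r}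
    (hne : p ≠ s) (h1 : KR p q) (h2 : KR q s) : KC a p ≠ KC a s := by
  have h3 := ha.ne2
  have h4 := ha.inj
  have h5 := ha.ne
  cases h1 <;> cases h2 <;> simp [KC] at * <;> grind

lemma KC3 {r : ℕ} {a : Fin r → Fin r → Fin r} (ha : KGood a) {p q s t : KN r}
    (hne : p ≠ t) (h1 : KR p q) (h2 : KR q s) (h3 : KR s t) : KC a p ≠ KC a t := by
  have h3 := ha.ne2
  have h4 := ha.inj
  have h5 := ha.ne
  have h6 := ha.anti
  rename_i h7
  cases h1 <;> cases h2 <;> cases h7 <;> simp [KC] at * <;> grind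

lemma KC_walk {r : ℕ} {a : Fin r → Fin r → Fin r} (ha : KGood a) {x y : KV r} (hne : x ≠ y)
    (w : (subdivision (⊤ : SimpleGraph (Fin r)) 5).Walk x y) (hw : w.length ≤ 3) :
    KC a (KNF x) ≠ KC a (KNF y) := by
  have hn : KNF x ≠ KNF y := fun e => hne (KNF_inj e)
  match w, hw with
  | .nil, _ => exact absurd rfl hne
  | .cons h1 .nil, _ => exact KC1 ha (KR_adj h1)
  | .cons h1 (.cons h2 .nil), _ => exact KC2 ha hn (KR_adj h1) (KR_adj h2)
  | .cons h1 (.cons h2 (.cons h3 .nil)), _ => exact KC3 ha hn (KR_adj h1) (KR_adj h2) (KR_adj h3)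
  | .cons h1 (.cons h2 (.cons h3 (.cons h4 w))), hw =>
    simp only [SimpleGraph.Walk.length_cons] at hw
    omega

lemma K_colorable {r : ℕ} {a : Fin r → Fin r → Fin r} (ha : KGood a) :
    (fracPower (⊤ : SimpleGraph (Fin r)) 3 5).Colorable (r + 1) := by
  have C : (fracPower (⊤ : SimpleGraph (Fin r)) 3 5).Coloring (Option (Fin r)) :=
    SimpleGraph.Coloring.mk (fun x => KC a (KNF x)) (by
      intro x y h
      rw [fracPower, powerGraph, SimpleGraph.fromRel_adj] at h
      obtain ⟨hne, ⟨w, hw⟩ | ⟨w, hw⟩⟩ := h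
      · exact KC_walk ha hne w hw
      · exact (KC_walk ha hne.symm w hw).symm)
  simpa using C.colorable

/-- The circulant permutation (with `t = 1`). -/
def KS {R : Type*} [CommRing R] [DecidableEq R] (t d : R) : R :=
  if d = 0 then 0 else if d = t then -t else if d = -t then 2 * t else if d = -(2 * t) then 3 * t
  else if d = 2 * t then t else d + t

lemma K_exists_big {R : Type*} [CommRing R] [DecidableEq R] (t : R) (h1 : t ≠ 0) (h2 : 2 * t ≠ 0)
    (h3 : 3 * t ≠ 0) (h4 : 4 * t ≠ 0) (h5 : 5 * t ≠ 0) :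
    (∀ d e : R, KS t d = KS t e → d = e) ∧ (∀ d : R, d ≠ 0 → KS t d ≠ d) ∧
    (∀ d : R, d ≠ 0 → KS t d ≠ d + KS t (-d)) := by
  refine ⟨?_, ?_, ?_⟩
  · intro d e
    unfold KS
    split_ifs <;> grind
  · intro d
    unfold KS
    split_ifs <;> grind
  · intro d h0
    have e1 : KS t t = -t := by simp [KS, h1]
    have e2 : KS t (-t) = 2 * t := by unfold KS; split_ifs <;> grind
    have e3 : KS t (-(2 * t)) = 3 * t := by unfold KS; split_ifs <;> grind
    have e4 : KS t (2 * t) = t := by unfold KS; split_ifs <;> grind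
    by_cases c1 : d = t
    · subst c1; rw [e1, e2]; grind
    by_cases c2 : d = -t
    · subst c2; rw [neg_neg, e1, e2]; grind
    by_cases c3 : d = -(2 * t)
    · subst c3; rw [neg_neg, e3, e4]; grind
    by_cases c4 : d = 2 * t
    · subst c4; rw [e3, e4]; grind
    have f1 : -d ≠ t := fun e => c2 (by rw [← e, neg_neg])
    have f2 : -d ≠ -t := fun e => c1 (neg_injective e)
    have f3 : -d ≠ -(2 * t) := fun e => c4 (neg_injective e)
    have f4 : -d ≠ 2 * t := fun e => c3 (by rw [← e, neg_neg])
    have f0 : -d ≠ 0 := neg_ne_zero.2 h0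
    rw [KS, if_neg h0, if_neg c1, if_neg c2, if_neg c3, if_neg c4,
      KS, if_neg f0, if_neg f1, if_neg f2, if_neg f3, if_neg f4]
    grind

lemma K_exists (r : ℕ) (hr : 4 ≤ r) : ∃ a : Fin r → Fin r → Fin r, KGood a := by
  obtain rfl | rfl | h6 : r = 4 ∨ r = 5 ∨ 6 ≤ r := by omega
  · refine ⟨![![0, 2, 3, 1], ![3, 1, 0, 2], ![1, 3, 2, 0], ![2, 0, 1, 3]], ?_, ?_, ?_, ?_⟩ <;> decide
  · refine ⟨fun u v => 2 * v - u, ?_, ?_, ?_, ?_⟩ <;> decide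
  · obtain ⟨n, rfl⟩ : ∃ n, r = n + 1 := ⟨r - 1, by omega⟩
    have key : ∀ k : ℕ, 0 < k → k < 6 → ((k : ℕ) : ZMod (n + 1)) ≠ 0 := by
      intro k hk hk2 h
      rw [ZMod.natCast_eq_zero_iff] at h
      have := Nat.le_of_dvd hk h
      omega
    obtain ⟨i1, i2, i3⟩ := K_exists_big (R := ZMod (n + 1)) 1
      (by simpa using key 1 (by omega) (by omega)) (by simpa using key 2 (by omega) (by omega))
      (by simpa using key 3 (by omega) (by omega)) (by simpa using key 4 (by omega) (by omega))
      (by simpa using key 5 (by omega) (by omega))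
    have : ∃ a : ZMod (n + 1) → ZMod (n + 1) → ZMod (n + 1),
        (∀ u v w, a u v = a u w → v = w) ∧ (∀ u, a u u = u) ∧ (∀ u v, u ≠ v → a u v ≠ v) ∧
        (∀ u v, u ≠ v → a u v ≠ a v u) := by
      refine ⟨fun u v => u + KS 1 (v - u), ?_, ?_, ?_, ?_⟩
      · intro u v w h
        exact sub_left_injective (i1 _ _ (add_left_cancel h))
      · intro u
        simp [KS]
      · intro u v huv h
        exact i2 (v - u) (sub_ne_zero.2 huv.symm) (by linear_combination h)
      · intro u v huv h
        refine i3 (v - u) (sub_ne_zero.2 huv.symm) ?_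
        rw [neg_sub]
        linear_combination h
    obtain ⟨a, b1, b2, b3, b4⟩ := this
    exact ⟨a, b1, b2, b3, b4⟩

lemma K_adj {r : ℕ} {u v : Fin r} (h : (⊤ : SimpleGraph (Fin r)).Adj u v) (i : ℕ) (hi : i < 5) :
    (subdivision (⊤ : SimpleGraph (Fin r)) 5).Adj
      (mkVert _ 5 h i hi.le) (mkVert _ 5 h (i+1) hi) := by
  rw [subdivision, SimpleGraph.fromRel_adj]
  refine ⟨fun e => ?_, Or.inl ⟨u, v, h, i, hi, rfl, rfl⟩⟩
  have hne : u ≠ v := h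
  have := KR_mk h i hi
  rw [← e] at this
  generalize KNF (mkVert (⊤ : SimpleGraph (Fin r)) 5 h i hi.le) = z at this
  cases this
  exact absurd rfl (by assumption)

lemma K_clique (r : ℕ) (hr : 4 ≤ r) :
    ∃ s, (fracPower (⊤ : SimpleGraph (Fin r)) 3 5).IsNClique (r + 1) s := by
  classical
  let z : Fin r := ⟨0, by omega⟩
  let o : Fin r := ⟨1, by omega⟩
  have hzo : (⊤ : SimpleGraph (Fin r)).Adj z o := by simp [z, o]
  let nf : Option (Fin r) → KN r := fun x => match x with
    | none => .two z o
    | some v => if v = z then .br z else .one z v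
  let d : Option (Fin r) → ℕ := fun x => match x with
    | none => 2
    | some v => if v = z then 0 else 1
  have hg : ∀ x, ∃ y : KV r, KNF y = nf x ∧
      ∃ w : (subdivision (⊤ : SimpleGraph (Fin r)) 5).Walk y (branchVertex _ _ z),
        w.length = d x := by
    intro x
    cases x with
    | none =>
      refine ⟨mkVert _ 5 hzo 2 (by omega), rfl, ?_⟩
      rw [← mk_zero hzo]
      exact ⟨.cons (K_adj hzo 1 (by omega)).symm (.cons (K_adj hzo 0 (by omega)).symm .nil), rfl⟩
    | some v =>
      by_cases hv : v = z
      · refine ⟨branchVertex _ _ z, ?_, .nil, ?_⟩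
        · simp only [nf, if_pos hv]; rfl
        · simp [d, hv]
      · have h : (⊤ : SimpleGraph (Fin r)).Adj z v := fun e => hv e.symm
        refine ⟨mkVert _ 5 h 1 (by omega), ?_, ?_⟩
        · simp only [nf, if_neg hv]; rfl
        · rw [← mk_zero h]
          exact ⟨.cons (K_adj h 0 (by omega)).symm .nil, by simp [d, hv]⟩
  choose g hg1 w hw using hg
  have hinj : Function.Injective g := by
    intro x y e
    have e2 : nf x = nf y := by rw [← hg1, ← hg1, e]
    cases x <;> cases y <;> simp only [nf] at e2 <;> grind
  have hd : ∀ x y, x ≠ y → d x + d y ≤ 3 := by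
    intro x y hxy
    cases x <;> cases y <;> simp only [d] <;> grind
  refine ⟨Finset.univ.image g, ?_, ?_⟩
  · intro x hx y hy hne
    simp only [Finset.coe_image, Finset.coe_univ, Set.image_univ, Set.mem_range] at hx hy
    obtain ⟨x, rfl⟩ := hx
    obtain ⟨y, rfl⟩ := hy
    rw [fracPower, powerGraph, SimpleGraph.fromRel_adj]
    refine ⟨hne, Or.inl ⟨(w x).append (w y).reverse, ?_⟩⟩
    have := hd x y (fun e => hne (by rw [e]))
    simpa [hw] using this
  · rw [Finset.card_image_of_injective _ hinj]
    simp

theorem complete_graph_three_fifths (r : ℕ) (hr : 4 ≤ r) :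
    (fracPower (⊤ : SimpleGraph (Fin r)) 3 5).cliqueNum = r + 1 ∧
    (fracPower (⊤ : SimpleGraph (Fin r)) 3 5).chromaticNumber = ((r + 1 : ℕ) : ℕ∞) := by
  obtain ⟨a, ha⟩ := K_exists r hr
  have hc := K_colorable ha
  obtain ⟨s, hs⟩ := K_clique r hr
  constructor
  · apply le_antisymm
    · refine csSup_le ⟨r + 1, s, hs⟩ ?_
      rintro n ⟨t, ht⟩
      rw [← ht.card_eq]
      exact ht.isClique.card_le_of_colorable hc
    · refine le_csSup ⟨r + 1, ?_⟩ ⟨s, hs⟩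
      rintro n ⟨t, ht⟩
      rw [← ht.card_eq]
      exact ht.isClique.card_le_of_colorable hc
  · apply le_antisymm
    · exact hc.chromaticNumber_le
    · rw [← hs.card_eq]
      exact hs.isClique.card_le_chromaticNumber
end

section
/- Let G be a finite simple graph with maximum degree Δ ≥ 4. For every 4-dynamic proper Δ-coloring f of G there exists a half-edge coloring h : E(G^{1/2}) → {1, …, Δ} such that f and h are compatible, i.e., no half-edge e_{uv} satisfies h(e_{uv}) = f(v). -/
open SimpleGraph

/-- The half-edge `e_{uv}`: the edge of the `2`-subdivision `G^{1/2}` joining the branch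
vertex `u` to the subdivision vertex of the edge `uv`. -/
def halfEdge {V : Type*} (G : SimpleGraph V) {u v : V} (h : G.Adj u v) :
    Sym2 (SubdivVert G 2) :=
  s(branchVertex G 2 u, mkVert G 2 h 1 (by omega))

/-- `h` is a proper edge coloring of `H`: distinct edges sharing a vertex get
different colors. -/
def IsProperEdgeColoring {W : Type*} (H : SimpleGraph W) (h : Sym2 W → ℕ) : Prop :=
  ∀ e₁ ∈ H.edgeSet, ∀ e₂ ∈ H.edgeSet, e₁ ≠ e₂ → (∃ x, x ∈ e₁ ∧ x ∈ e₂) → h e₁ ≠ h e₂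

/-- Hall-type lemma for one vertex. -/
lemma hall_step {V : Type*} (N : Finset V) (f g : V → ℕ) (D : ℕ) (hD : 4 ≤ D)
    (hN : N.card ≤ D) (hdyn : min 4 N.card ≤ (N.image f).card) :
    (∃ h : V → ℕ, Set.InjOn h N ∧ ∀ v ∈ N, h v ∈ Finset.Icc 1 D ∧ h v ≠ f v ∧ h v ≠ g v) ∨
    (N.card = D ∧ ∃ a ∈ Finset.Icc 1 D, ∀ v ∈ N, f v = a ∨ g v = a) := by
  classical
  let L : {v // v ∈ N} → Finset ℕ := fun v => Finset.Icc 1 D \ {f v, g v}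
  by_cases hall : ∀ s : Finset {v // v ∈ N}, s.card ≤ (s.biUnion L).card
  · left
    obtain ⟨k, hk, hkL⟩ := (Finset.all_card_le_biUnion_card_iff_exists_injective L).1 hall
    refine ⟨fun v => if hv : v ∈ N then k ⟨v, hv⟩ else 0, ?_, ?_⟩
    · intro v hv w hw hvw
      have hv' : v ∈ N := hv
      have hw' : w ∈ N := hw
      simp only [hv', hw', dif_pos] at hvw
      have := hk hvw
      simpa using this
    · intro v hv
      have := hkL ⟨v, hv⟩
      simp only [L, Finset.mem_sdiff, Finset.mem_insert, Finset.mem_singleton, not_or] at this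
      simp only [hv, dif_pos]
      exact ⟨this.1, this.2.1, this.2.2⟩
  · right
    push Not at hall
    obtain ⟨s, hs⟩ := hall
    let S : Finset V := s.map (Function.Embedding.subtype _)
    have hScard : S.card = s.card := Finset.card_map _
    have hSN : S ⊆ N := by
      intro v hv
      simp only [S, Finset.mem_map, Function.Embedding.subtype_apply] at hv
      obtain ⟨w, _, rfl⟩ := hv
      exact w.2
    let C : Finset ℕ := Finset.Icc 1 D \ s.biUnion L
    have hsub : s.biUnion L ⊆ Finset.Icc 1 D := by
      intro a ha
      simp only [Finset.mem_biUnion, L, Finset.mem_sdiff] at ha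
      obtain ⟨_, _, h, _⟩ := ha
      exact h
    have hCcard : C.card + (s.biUnion L).card = D := by
      have := Finset.card_sdiff_add_card_eq_card hsub
      simpa [C] using this
    have hC : ∀ a ∈ C, ∀ v ∈ S, a = f v ∨ a = g v := by
      intro a ha v hv
      simp only [S, Finset.mem_map, Function.Embedding.subtype_apply] at hv
      obtain ⟨w, hw, rfl⟩ := hv
      by_contra hcon
      simp only [C, Finset.mem_sdiff] at ha
      apply ha.2
      simp only [Finset.mem_biUnion, L, Finset.mem_sdiff, Finset.mem_insert,
        Finset.mem_singleton]
      exact ⟨w, hw, ha.1, hcon⟩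
    have hSle : S.card ≤ N.card := Finset.card_le_card hSN
    have hSne : S.Nonempty := by
      rw [← Finset.card_pos]; omega
    have hCsub : ∀ v ∈ S, C ⊆ {f v, g v} := by
      intro v hv a ha
      simpa using hC a ha v hv
    have hC2 : C.card ≤ 2 := by
      obtain ⟨v, hv⟩ := hSne
      exact (Finset.card_le_card (hCsub v hv)).trans Finset.card_le_two
    by_cases hC2' : C.card = 2
    · exfalso
      have himg : S.image f ⊆ C := by
        intro b hb
        obtain ⟨v, hv, rfl⟩ := Finset.mem_image.1 hb
        have : C = {f v, g v} := Finset.eq_of_subset_of_card_le (hCsub v hv)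
          (by rw [hC2']; exact Finset.card_le_two)
        rw [this]; simp
      have h1 : (S.image f).card ≤ 2 := hC2' ▸ Finset.card_le_card himg
      have h2 : (N.image f).card ≤ (S.image f).card + (N \ S).card := by
        have : N.image f ⊆ S.image f ∪ (N \ S).image f := by
          rw [← Finset.image_union, Finset.union_sdiff_of_subset hSN]
        exact (Finset.card_le_card this).trans ((Finset.card_union_le _ _).trans
          (Nat.add_le_add_left Finset.card_image_le _))
      have h3 := Finset.card_sdiff_add_card_eq_card hSN
      omega
    · have hSD : S.card = N.card := by omega
      have hSeq : S = N := Finset.eq_of_subset_of_card_le hSN hSD.ge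
      refine ⟨by omega, ?_⟩
      have : 0 < C.card := by omega
      obtain ⟨a, ha⟩ := Finset.card_pos.1 this
      refine ⟨a, (Finset.mem_sdiff.1 ha).1, ?_⟩
      intro v hv
      rcases hC a ha v (hSeq ▸ hv) with h | h
      · exact Or.inl h.symm
      · exact Or.inr h.symm

/-- `c` colors the half-edges at the vertices of `P` validly. -/
def ValidOn {V : Type*} (G : SimpleGraph V) (f : V → ℕ) (D : ℕ) (P : Set V)
    (c : V → V → ℕ) : Prop :=
  (∀ u ∈ P, ∀ v, G.Adj u v → c u v ∈ Finset.Icc 1 D ∧ c u v ≠ f v) ∧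
  (∀ u ∈ P, ∀ v w, G.Adj u v → G.Adj u w → c u v = c u w → v = w) ∧
  (∀ u ∈ P, ∀ v ∈ P, G.Adj u v → c u v ≠ c v u)

lemma ValidOn.mono {V : Type*} {G : SimpleGraph V} {f : V → ℕ} {D : ℕ} {P P' : Set V}
    {c : V → V → ℕ} (h : ValidOn G f D P c) (hP : P' ⊆ P) : ValidOn G f D P' c :=
  ⟨fun u hu => h.1 u (hP hu), fun u hu => h.2.1 u (hP hu),
    fun u hu v hv => h.2.2 u (hP hu) v (hP hv)⟩

section
variable {V : Type*} [Fintype V] (G : SimpleGraph V) [DecidableRel G.Adj]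

/-- Being stuck at `x` with color `a`. -/
def StuckAt (f : V → ℕ) (P : Set V) (c : V → V → ℕ) (x : V) (a : ℕ) : Prop :=
  G.degree x = G.maxDegree ∧ a ∈ Finset.Icc 1 G.maxDegree ∧
    ∀ v, G.Adj x v → f v = a ∨ (v ∈ P ∧ c v x = a)

lemma ext_step (hΔ : 4 ≤ G.maxDegree) (f : V → ℕ)
    (hdyn : ∀ v : V, min 4 (G.degree v) ≤ ((G.neighborFinset v).image f).card)
    (hf1 : ∀ v, f v ∈ Finset.Icc 1 G.maxDegree)
    (P : Set V) (c : V → V → ℕ) (x : V) (hx : x ∉ P) (hc : ValidOn G f G.maxDegree P c) :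
    (∃ c', ValidOn G f G.maxDegree (insert x P) c' ∧ ∀ u, u ≠ x → c' u = c u) ∨
    ∃ a, StuckAt G f P c x a := by
  classical
  rcases hall_step (G.neighborFinset x) f (fun v => if v ∈ P then c v x else 0) G.maxDegree hΔ
    (by rw [card_neighborFinset_eq_degree]; exact G.degree_le_maxDegree x)
    (by rw [card_neighborFinset_eq_degree]; exact hdyn x) with ⟨h, hinj, hh⟩ | ⟨hd, a, ha, hst⟩
  · left
    refine ⟨Function.update c x h, ⟨?_, ?_, ?_⟩, fun u hu => Function.update_of_ne hu _ _⟩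
    · intro u hu v huv
      by_cases hux : u = x
      · subst hux
        have := hh v (by simpa using huv)
        simp only [Function.update_self]
        exact ⟨this.1, this.2.1⟩
      · rw [Function.update_of_ne hux]
        exact hc.1 u (hu.resolve_left hux) v huv
    · intro u hu v w huv huw he
      by_cases hux : u = x
      · subst hux
        simp only [Function.update_self] at he
        exact hinj (by simpa using huv) (by simpa using huw) he
      · rw [Function.update_of_ne hux] at he
        exact hc.2.1 u (hu.resolve_left hux) v w huv huw he
    · intro u hu v hv huv
      by_cases hux : u = x
      · subst hux
        have hvu : v ≠ u := huv.ne'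
        have hvP := hv.resolve_left hvu
        have := (hh v (by simpa using huv)).2.2
        simp only [hvP, if_true] at this
        rw [Function.update_self, Function.update_of_ne hvu]
        exact this
      · have huP := hu.resolve_left hux
        by_cases hvx : v = x
        · subst hvx
          have := (hh u (by simpa using huv.symm)).2.2
          simp only [huP, if_true] at this
          rw [Function.update_self, Function.update_of_ne hux]
          exact this.symm
        · rw [Function.update_of_ne hux, Function.update_of_ne hvx]
          exact hc.2.2 u huP v (hv.resolve_left hvx) huv
  · right
    refine ⟨a, by rw [← card_neighborFinset_eq_degree]; exact hd, ha, ?_⟩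
    intro v hv
    rcases hst v (by simpa using hv) with h | h
    · exact Or.inl h
    · right
      have ha1 := (Finset.mem_Icc.1 ha).1
      by_cases hvP : v ∈ P
      · simp only [hvP, if_true] at h
        exact ⟨hvP, h⟩
      · simp only [hvP, if_false] at h
        omega

lemma exists_nbr (hΔ : 4 ≤ G.maxDegree) (f : V → ℕ)
    (hdyn : ∀ v : V, min 4 (G.degree v) ≤ ((G.neighborFinset v).image f).card)
    (x : V) (hx : G.degree x = G.maxDegree) (a b : ℕ) :
    ∃ v, G.Adj x v ∧ f v ≠ a ∧ f v ≠ b := by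
  classical
  have h1 := hdyn x
  have h2 : 0 < ((G.neighborFinset x).image f \ {a, b}).card := by
    have := Finset.le_card_sdiff ({a, b} : Finset ℕ) ((G.neighborFinset x).image f)
    have h3 : ({a, b} : Finset ℕ).card ≤ 2 := Finset.card_le_two
    omega
  obtain ⟨k, hk⟩ := Finset.card_pos.1 h2
  simp only [Finset.mem_sdiff, Finset.mem_image, mem_neighborFinset, Finset.mem_insert,
    Finset.mem_singleton, not_or] at hk
  obtain ⟨⟨v, hv, rfl⟩, h⟩ := hk
  exact ⟨v, hv, h⟩

lemma move_step (hΔ : 4 ≤ G.maxDegree) (f : V → ℕ)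
    (hdyn : ∀ v : V, min 4 (G.degree v) ≤ ((G.neighborFinset v).image f).card)
    (hf1 : ∀ v, f v ∈ Finset.Icc 1 G.maxDegree)
    (Q : Set V) (hQ : ¬ ∃ c, ValidOn G f G.maxDegree Q c)
    (c : V → V → ℕ) (x v : V) (a : ℕ) (hx : x ∈ Q)
    (hc : ValidOn G f G.maxDegree (Q \ {x}) c)
    (hst : StuckAt G f (Q \ {x}) c x a) (hxv : G.Adj x v) (hva : f v ≠ a) :
    v ∈ Q ∧ ∃ c', ValidOn G f G.maxDegree (Q \ {v}) c' ∧ StuckAt G f (Q \ {v}) c' v a ∧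
      (∀ u, u ≠ x → c' u = c u) ∧ c' x v = a := by
  obtain ⟨hdeg, ha, hs⟩ := hst
  obtain ⟨hvP, hcv⟩ := (hs v hxv).resolve_left hva
  have hfx : f x ≠ a := fun h => (hc.1 v hvP x hxv.symm).2 (hcv.trans h.symm)
  refine ⟨hvP.1, ?_⟩
  have hvx : v ≠ x := hxv.ne'
  have hins : insert x ((Q \ {x}) \ {v}) = Q \ {v} := by
    ext y
    simp only [Set.mem_insert_iff, Set.mem_sdiff, Set.mem_singleton_iff]
    constructor
    · rintro (rfl | h)
      · exact ⟨hx, hvx.symm⟩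
      · exact ⟨h.1.1, h.2⟩
    · rintro ⟨h1, h2⟩
      by_cases hy : y = x
      · exact Or.inl hy
      · exact Or.inr ⟨⟨h1, hy⟩, h2⟩
  rcases ext_step G hΔ f hdyn hf1 ((Q \ {x}) \ {v}) c x (by simp)
    (hc.mono Set.sdiff_subset) with ⟨c', hc', hag⟩ | ⟨b, _, _, hb⟩
  · rw [hins] at hc'
    have hstv : StuckAt G f (Q \ {v}) c' v a := by
      rcases ext_step G hΔ f hdyn hf1 (Q \ {v}) c' v (by simp) hc' with ⟨c2, hc2, _⟩ | ⟨b, hb⟩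
      · exfalso
        rw [Set.insert_sdiff_singleton, Set.insert_eq_of_mem hvP.1] at hc2
        exact hQ ⟨c2, hc2⟩
      · suffices hab : b = a by rwa [hab] at hb
        obtain ⟨hdv, hbI, hbs⟩ := hb
        obtain ⟨w, hw, hcw⟩ : ∃ w ∈ G.neighborFinset v, c v w = b := by
          have := Finset.surj_on_of_inj_on_of_card_le (s := G.neighborFinset v)
            (t := Finset.Icc 1 G.maxDegree) (fun w _ => c v w)
            (fun w hw => (hc.1 v hvP w (by simpa using hw)).1)
            (fun w w' hw hw' h => hc.2.1 v hvP w w' (by simpa using hw) (by simpa using hw') h)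
            (by simp [hdv]) b hbI
          obtain ⟨w, hw, h⟩ := this
          exact ⟨w, hw, h.symm⟩
        rw [mem_neighborFinset] at hw
        by_cases hwx : w = x
        · subst hwx
          exact hcw.symm.trans hcv
        · exfalso
          rcases hbs w hw with h | ⟨h1, h2⟩
          · exact (hc.1 v hvP w hw).2 (hcw.trans h.symm)
          · rw [hag w hwx] at h2
            exact hc.2.2 v hvP w ⟨h1.1, hwx⟩ hw (hcw.trans h2.symm)
    exact ⟨c', hc', hstv, hag, ((hstv.2.2 x hxv.symm).resolve_left hfx).2⟩
  · exfalso
    have hbv : f v = b := by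
      rcases hb v hxv with h | h
      · exact h
      · exact absurd rfl h.1.2
    obtain ⟨w, hw, hwa, hwb⟩ := exists_nbr G hΔ f hdyn x hdeg a b
    have h1 := ((hs w hw).resolve_left hwa).2
    have h2 := ((hb w hw).resolve_left hwb).2
    exact hva (hbv.trans (h2.symm.trans h1))

lemma extend_valid (hΔ : 4 ≤ G.maxDegree) (f : V → ℕ)
    (hdyn : ∀ v : V, min 4 (G.degree v) ≤ ((G.neighborFinset v).image f).card)
    (hf1 : ∀ v, f v ∈ Finset.Icc 1 G.maxDegree)
    (P : Set V) (x : V) (hx : x ∉ P) (c : V → V → ℕ) (hc : ValidOn G f G.maxDegree P c) :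
    ∃ c', ValidOn G f G.maxDegree (insert x P) c' := by
  classical
  by_contra hQ
  have hPQ : insert x P \ {x} = P := by
    rw [Set.insert_sdiff_of_mem _ (Set.mem_singleton x), Set.sdiff_singleton_eq_self hx]
  obtain ⟨a, ha⟩ : ∃ a, StuckAt G f P c x a := by
    rcases ext_step G hΔ f hdyn hf1 P c x hx hc with ⟨c', h, _⟩ | h
    · exact absurd ⟨c', h⟩ hQ
    · exact h
  set Q := insert x P with hQdef
  have key : ∀ n : ℕ, ∃ (s : ℕ → V) (c : V → V → ℕ), Set.InjOn s (Set.Iic n) ∧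
      (∀ i ≤ n, s i ∈ Q) ∧
      ValidOn G f G.maxDegree (Q \ {s n}) c ∧ StuckAt G f (Q \ {s n}) c (s n) a ∧
      ∀ i < n, G.Adj (s i) (s (i + 1)) ∧ c (s i) (s (i + 1)) = a := by
    intro n
    induction n with
    | zero =>
      refine ⟨fun _ => x, c, ?_, ?_, ?_, ?_, ?_⟩
      · intro i hi j hj _
        simp only [Set.mem_Iic] at hi hj
        omega
      · intro _ _; exact Set.mem_insert _ _
      · rwa [hPQ]
      · rwa [hPQ]
      · intro i hi; omega
    | succ n ih =>
      obtain ⟨s, c, hinj, hsQ, hv, hst, hd⟩ := ih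
      obtain ⟨v, hadj, hva, hvb⟩ := exists_nbr G hΔ f hdyn (s n) hst.1 a (f (s (n - 1)))
      obtain ⟨hvQ, c', hv', hst', hag, hcv⟩ :=
        move_step G hΔ f hdyn hf1 Q hQ c (s n) v a (hsQ n le_rfl) hv hst hadj hva
      have hcvn := ((hst.2.2 v hadj).resolve_left hva)
      have hnew : ∀ i ≤ n, s i ≠ v := by
        intro i hi hiv
        rcases Nat.lt_or_eq_of_le hi with h | h
        · obtain ⟨h1, h2⟩ := hd i h
          rw [hiv] at h1 h2
          have h3 := hv.2.1 v hcvn.1 _ _ h1 hadj.symm (h2.trans hcvn.2.symm)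
          have h4 := hinj (Set.mem_Iic.2 h) (Set.mem_Iic.2 le_rfl) h3
          have h5 : n - 1 = i := by omega
          rw [h5, hiv] at hvb
          exact hvb rfl
        · subst h
          exact hadj.ne hiv
      have hold : ∀ i ≤ n, Function.update s (n + 1) v i = s i := fun i hi =>
        Function.update_of_ne (by omega) _ _
      refine ⟨Function.update s (n + 1) v, c', ?_, ?_, ?_, ?_, ?_⟩
      · intro i hi j hj hij
        simp only [Set.mem_Iic] at hi hj
        rcases Nat.lt_or_eq_of_le hi with h | h <;> rcases Nat.lt_or_eq_of_le hj with h' | h'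
        · rw [hold i (by omega), hold j (by omega)] at hij
          exact hinj (Set.mem_Iic.2 (by omega)) (Set.mem_Iic.2 (by omega)) hij
        · subst h'
          rw [hold i (by omega), Function.update_self] at hij
          exact absurd hij (hnew i (by omega))
        · subst h
          rw [hold j (by omega), Function.update_self] at hij
          exact absurd hij.symm (hnew j (by omega))
        · omega
      · intro i hi
        rcases Nat.lt_or_eq_of_le hi with h | h
        · rw [hold i (by omega)]; exact hsQ i (by omega)
        · subst h; rwa [Function.update_self]
      · rwa [Function.update_self]
      · rwa [Function.update_self]
      · intro i hi
        rcases Nat.lt_or_eq_of_le (Nat.lt_succ_iff.1 hi) with h | h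
        · rw [hold i (by omega), hold (i + 1) (by omega), hag (s i)]
          · exact hd i h
          · intro he
            have := hinj (Set.mem_Iic.2 h.le) (Set.mem_Iic.2 le_rfl) he
            omega
        · subst h
          rw [hold i le_rfl, Function.update_self]
          exact ⟨hadj, hcv⟩
  obtain ⟨s, _, hinj, _⟩ := key (Fintype.card V)
  have hcard : ((Finset.range (Fintype.card V + 1)).image s).card = Fintype.card V + 1 := by
    rw [Finset.card_image_of_injOn, Finset.card_range]
    intro i hi j hj h
    simp only [Finset.coe_range, Set.mem_Iio] at hi hj
    exact hinj (Set.mem_Iic.2 (by omega)) (Set.mem_Iic.2 (by omega)) h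
  have := Finset.card_le_univ ((Finset.range (Fintype.card V + 1)).image s)
  omega

lemma exists_valid (hΔ : 4 ≤ G.maxDegree) (f : V → ℕ)
    (hdyn : ∀ v : V, min 4 (G.degree v) ≤ ((G.neighborFinset v).image f).card)
    (hf1 : ∀ v, f v ∈ Finset.Icc 1 G.maxDegree) :
    ∃ c, ValidOn G f G.maxDegree Set.univ c := by
  classical
  have : ∀ P : Finset V, ∃ c, ValidOn G f G.maxDegree (P : Set V) c := by
    intro P
    induction P using Finset.induction_on with
    | empty => exact ⟨fun _ _ => 0, by simp [ValidOn]⟩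
    | insert x P hx ih =>
      obtain ⟨c, hc⟩ := ih
      rw [Finset.coe_insert]
      exact extend_valid G hΔ f hdyn hf1 P x (by simpa using hx) c hc
  simpa using this Finset.univ

end

/-- An invariant of points of the `2`-subdivision. -/
def subdivInv {V : Type*} (G : SimpleGraph V) : SubdivVert G 2 → Sym2 V :=
  Quot.lift (fun p => if p.1.2.2 = 0 then s(p.1.1, p.1.1) else
    if p.1.2.2 = 1 then s(p.1.1, p.1.2.1) else s(p.1.2.1, p.1.2.1)) (by
    intro p q h
    cases h with
    | flip u v i h hi =>
      have : i = 0 ∨ i = 1 ∨ i = 2 := by omega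
      rcases this with rfl | rfl | rfl <;> simp [Sym2.eq_swap]
    | collapse u v h => simp)

lemma subdivInv_branch {V : Type*} (G : SimpleGraph V) (u : V) :
    subdivInv G (branchVertex G 2 u) = s(u, u) := rfl

lemma subdivInv_mid {V : Type*} (G : SimpleGraph V) {u v : V} (h : G.Adj u v) (hi : 1 ≤ 2) :
    subdivInv G (mkVert G 2 h 1 hi) = s(u, v) := rfl

lemma halfEdge_inj {V : Type*} (G : SimpleGraph V) {u v u' v' : V} (h : G.Adj u v)
    (h' : G.Adj u' v') (he : halfEdge G h = halfEdge G h') : u = u' ∧ v = v' := by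
  have := congrArg (Sym2.map (subdivInv G)) he
  simp only [halfEdge, Sym2.map_mk, subdivInv_branch, subdivInv_mid] at this
  have n1 := h.ne
  have n2 := h'.ne
  simp only [Sym2.eq_iff] at this
  grind

lemma edge_eq_halfEdge {V : Type*} (G : SimpleGraph V) (e : Sym2 (SubdivVert G 2))
    (he : e ∈ (subdivision G 2).edgeSet) :
    ∃ (u v : V) (h : G.Adj u v), e = halfEdge G h := by
  have aux : ∀ x y : SubdivVert G 2, (∃ (u v : V) (h : G.Adj u v) (i : ℕ) (hi : i < 2),
      x = mkVert G 2 h i (le_of_lt hi) ∧ y = mkVert G 2 h (i + 1) hi) →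
      ∃ (u v : V) (h : G.Adj u v), s(x, y) = halfEdge G h := by
    rintro x y ⟨u, v, h, i, hi, rfl, rfl⟩
    have : i = 0 ∨ i = 1 := by omega
    rcases this with rfl | rfl
    · refine ⟨u, v, h, ?_⟩
      have h0 : mkVert G 2 h 0 (by omega) = branchVertex G 2 u :=
        Quot.sound (SubdivRel.collapse u v h)
      rw [h0]; rfl
    · refine ⟨v, u, h.symm, ?_⟩
      have h1 : mkVert G 2 h 1 (by omega) = mkVert G 2 h.symm 1 (by omega) :=
        Quot.sound (SubdivRel.flip u v 1 h (by omega))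
      have h2 : mkVert G 2 h 2 (by omega) = branchVertex G 2 v :=
        (Quot.sound (SubdivRel.flip u v 2 h (by omega))).trans
          (Quot.sound (SubdivRel.collapse v u h.symm))
      rw [h1]
      change s(_, mkVert G 2 h 2 _) = _
      rw [h2, Sym2.eq_swap]; rfl
  induction e using Sym2.ind with
  | _ x y =>
    rw [mem_edgeSet, subdivision, fromRel_adj] at he
    rcases he.2 with h | h
    · exact aux x y h
    · rw [Sym2.eq_swap]; exact aux y x h

theorem exists_compatible_of_four_dynamic {V : Type*} [Fintype V] (G : SimpleGraph V)
    [DecidableRel G.Adj] (hΔ : 4 ≤ G.maxDegree)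
    (f : V → ℕ) (hf1 : ∀ v, f v ∈ Finset.Icc 1 G.maxDegree)
    (hfproper : ∀ u v : V, G.Adj u v → f u ≠ f v)
    (hdyn : ∀ v : V, min 4 (G.degree v) ≤ ((G.neighborFinset v).image f).card) :
    ∃ h : Sym2 (SubdivVert G 2) → ℕ,
      (∀ e ∈ (subdivision G 2).edgeSet, h e ∈ Finset.Icc 1 G.maxDegree) ∧
      IsProperEdgeColoring (subdivision G 2) h ∧
      (∀ (u v : V) (huv : G.Adj u v), h (halfEdge G huv) ≠ f v) := by
  classical
  obtain ⟨c, hc1, hc2, hc3⟩ := exists_valid G hΔ f hdyn hf1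
  let h : Sym2 (SubdivVert G 2) → ℕ := fun e =>
    if he : ∃ p : V × V, ∃ hp : G.Adj p.1 p.2, e = halfEdge G hp then
      c he.choose.1 he.choose.2 else 0
  have hh : ∀ (u v : V) (huv : G.Adj u v), h (halfEdge G huv) = c u v := by
    intro u v huv
    have he : ∃ p : V × V, ∃ hp : G.Adj p.1 p.2, halfEdge G huv = halfEdge G hp :=
      ⟨(u, v), huv, rfl⟩
    simp only [h, dif_pos he]
    obtain ⟨hp, hpe⟩ := he.choose_spec
    obtain ⟨h1, h2⟩ := halfEdge_inj G huv hp hpe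
    rw [← h1, ← h2]
  refine ⟨h, ?_, ?_, ?_⟩
  · intro e he
    obtain ⟨u, v, huv, rfl⟩ := edge_eq_halfEdge G e he
    rw [hh]
    exact (hc1 u trivial v huv).1
  · intro e₁ he₁ e₂ he₂ hne hx
    obtain ⟨u, v, huv, rfl⟩ := edge_eq_halfEdge G e₁ he₁
    obtain ⟨u', v', huv', rfl⟩ := edge_eq_halfEdge G e₂ he₂
    rw [hh, hh]
    obtain ⟨x, hx1, hx2⟩ := hx
    have n1 := huv.ne
    have n2 := huv'.ne
    have hcase : u = u' ∨ (u = v' ∧ v = u') := by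
      simp only [halfEdge, Sym2.mem_iff] at hx1 hx2
      rcases hx1 with rfl | rfl <;> rcases hx2 with h | h <;>
        have h := congrArg (subdivInv G) h <;>
        simp only [subdivInv_branch, subdivInv_mid, Sym2.eq_iff] at h <;> grind
    rcases hcase with rfl | ⟨rfl, rfl⟩
    · intro hcc
      have := hc2 u trivial v v' huv huv' hcc
      subst this
      exact hne rfl
    · exact hc3 u trivial v trivial huv
  · intro u v huv
    rw [hh]
    exact (hc1 u trivial v huv).2
end
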